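/- arXiv:1401.1607 — 10 statements merged into one kernel-verified Lean document; each statement's English description precedes it below -/
import Mathlib

section
/- Let R be a commutative ring and A an R-algebra (not necessarily commutative). Let [A,A] denote the two-sided ideal of A generated by all commutators ab - ba with a, b ∈ A. Then A is R-futile if and only if the quotient algebra A/[A,A] is an R-futile algebra and the ideal [A,A] is a finite set. -/
/-- An `R`-algebra `A` is *futile* if it has only finitely many `R`-subalgebras. -/
def IsFutile (R A : Type*) [CommRing R] [Ring A] [Algebra R A] : Prop :=
  Finite (Subalgebra R A)

/-- The commutator ideal `[A,A]` of a ring `A`: the two-sided ideal generated by all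
commutators `a * b - b * a`. -/
def commutatorIdeal (A : Type*) [Ring A] : TwoSidedIdeal A :=
  TwoSidedIdeal.span {x : A | ∃ a b : A, x = a * b - b * a}

/-- The quotient of an `R`-algebra by a two-sided ideal is again an `R`-algebra. -/
instance twoSidedQuotAlgebra {R A : Type*} [CommRing R] [Ring A] [Algebra R A]
    (I : TwoSidedIdeal A) : Algebra R I.ringCon.Quotient :=
  RingHom.toAlgebra' ((RingCon.mk' I.ringCon).comp (algebraMap R A)) (by
    intro c x
    induction x using Quotient.inductionOn' with
    | h a => exact congrArg (Quotient.mk'') (Algebra.commutes c a))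

open scoped Pointwise

theorem IsFutile.of_surjective {R A B : Type*} [CommRing R] [Ring A] [Ring B] [Algebra R A]
    [Algebra R B] (f : A →ₐ[R] B) (hf : Function.Surjective f) (hA : IsFutile R A) :
    IsFutile R B :=
  have : Finite (Subalgebra R A) := hA
  Finite.of_injective (Subalgebra.comap f) fun _ _ hST =>
    SetLike.coe_injective (hf.preimage_injective (congrArg SetLike.coe hST))

/-- An algebra is futile if and only if it has a finite subset which meets every subalgebra in a
generating set of that subalgebra. -/
theorem isFutile_iff_exists_finite_generating {R A : Type*} [CommRing R] [Ring A] [Algebra R A] :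
    IsFutile R A ↔
      ∃ G : Set A, G.Finite ∧ ∀ S : Subalgebra R A, S ≤ Algebra.adjoin R (S ∩ G) := by
  constructor
  · intro hA
    have : Finite (Subalgebra R A) := hA
    have hsep (p : Subalgebra R A × Subalgebra R A) : ∃ x : A, ¬ p.1 ≤ p.2 → x ∈ p.1 ∧ x ∉ p.2 := by
      by_cases h : p.1 ≤ p.2
      · exact ⟨0, fun hn => absurd h hn⟩
      · obtain ⟨x, hx⟩ := SetLike.not_le_iff_exists.mp h
        exact ⟨x, fun _ => hx⟩
    choose g hg using hsep
    refine ⟨Set.range g, Set.finite_range g, fun S => ?_⟩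
    by_contra h
    obtain ⟨hS, hadj⟩ := hg (S, Algebra.adjoin R (S ∩ Set.range g)) h
    exact hadj (Algebra.subset_adjoin ⟨hS, Set.mem_range_self _⟩)
  · rintro ⟨G, hG, hgen⟩
    have : Finite (𝒫 G) := hG.finite_subsets
    refine Finite.of_injective
      (fun S : Subalgebra R A => (⟨S ∩ G, Set.inter_subset_right⟩ : 𝒫 G)) fun S T hST => ?_
    have hST' : (S : Set A) ∩ G = (T : Set A) ∩ G := congrArg Subtype.val hST
    apply le_antisymm
    · exact (hgen S).trans (hST' ▸ Algebra.adjoin_le Set.inter_subset_left)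
    · exact (hgen T).trans (hST' ▸ Algebra.adjoin_le Set.inter_subset_left)

theorem IsFutile.of_finite_ker {R A B : Type*} [CommRing R] [Ring A] [Ring B] [Algebra R A]
    [Algebra R B] (f : A →ₐ[R] B) (hker : {x : A | f x = 0}.Finite) (hB : IsFutile R B) :
    IsFutile R A := by
  obtain ⟨G, hG, hgen⟩ := isFutile_iff_exists_finite_generating.mp hB
  have hfib : (f ⁻¹' G).Finite := by
    refine Set.Finite.preimage' hG fun b _ => ?_
    obtain he | ⟨a, ha⟩ := (f ⁻¹' {b}).eq_empty_or_nonempty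
    · exact he ▸ Set.finite_empty
    · refine (hker.image (· + a)).subset fun x hx => ⟨x - a, ?_, sub_add_cancel x a⟩
      rw [Set.mem_preimage, Set.mem_singleton_iff] at ha hx
      rw [Set.mem_ofPred_eq, map_sub, ha, hx, sub_self]
  refine isFutile_iff_exists_finite_generating.mpr
    ⟨f ⁻¹' G ∪ {x | f x = 0}, hfib.union hker, fun S => ?_⟩
  set U := Algebra.adjoin R (S ∩ (f ⁻¹' G ∪ {x | f x = 0}))
  have hUS : U ≤ S := Algebra.adjoin_le Set.inter_subset_left
  have hmap : S.map f ≤ U.map f := by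
    refine (hgen _).trans (Algebra.adjoin_le ?_)
    rintro _ ⟨⟨s, hs, rfl⟩, hsG⟩
    exact ⟨s, Algebra.subset_adjoin ⟨hs, Or.inl hsG⟩, rfl⟩
  intro x hx
  obtain ⟨u, hu, hux⟩ := hmap ⟨x, hx, rfl⟩
  have hxu : x - u ∈ U :=
    Algebra.subset_adjoin ⟨sub_mem hx (hUS hu), Or.inr (by
      change f (x - u) = 0
      rw [map_sub, sub_eq_zero]
      exact hux.symm)⟩
  simpa using add_mem hxu hu

/-- A futile algebra is central-by-finite as an additive group. -/
theorem IsFutile.exists_finiteIndex_central {R A : Type*} [CommRing R] [Ring A] [Algebra R A]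
    (hA : IsFutile R A) :
    ∃ C : AddSubgroup A, C.FiniteIndex ∧ ∀ c ∈ C, ∀ x : A, c * x = x * c := by
  classical
  have : Finite (Subalgebra R A) := hA
  have := Fintype.ofFinite {S : Subalgebra R A // IsMulCommutative S}
  let H (S : {S : Subalgebra R A // IsMulCommutative S}) : AddSubgroup A :=
    S.1.toSubring.toAddSubgroup
  have hcover : ⋃ S ∈ Finset.univ, (0 : A) +ᵥ (H S : Set A) = Set.univ := by
    refine Set.eq_univ_of_forall fun a => ?_
    simp only [Finset.mem_univ, zero_vadd, Set.iUnion_true, Set.mem_iUnion]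
    exact ⟨⟨Algebra.adjoin R {a}, inferInstance⟩, Algebra.self_mem_adjoin_singleton R a⟩
  have hcover' := AddSubgroup.leftCoset_cover_filter_FiniteIndex hcover
  refine ⟨⨅ S ∈ Finset.univ.filter fun S => (H S).FiniteIndex, H S,
    AddSubgroup.finiteIndex_iInf' _ (by simp), fun c hc x => ?_⟩
  have hx : x ∈ ⋃ S ∈ Finset.univ.filter fun S => (H S).FiniteIndex, (0 : A) +ᵥ (H S : Set A) :=
    hcover' ▸ Set.mem_univ x
  simp only [zero_vadd, Set.mem_iUnion] at hx
  obtain ⟨S, hS, hxS⟩ := hx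
  have hcS : c ∈ H S := by
    simp only [AddSubgroup.mem_iInf] at hc
    exact hc S hS
  have := S.2
  exact setLike_mul_comm (s := S.1) hcS hxS

theorem finite_commutators_of_finiteIndex_central {A : Type*} [Ring A] (C : AddSubgroup A)
    [C.FiniteIndex] (hC : ∀ c ∈ C, ∀ x : A, c * x = x * c) :
    {x : A | ∃ a b : A, x = a * b - b * a}.Finite := by
  have : Finite (A ⧸ C) := AddSubgroup.finite_quotient_of_finiteIndex
  refine (Set.finite_range fun p : (A ⧸ C) × (A ⧸ C) =>
    p.1.out * p.2.out - p.2.out * p.1.out).subset ?_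
  rintro _ ⟨a, b, rfl⟩
  obtain ⟨c, hc⟩ := QuotientAddGroup.mk_out_eq_add C a
  obtain ⟨d, hd⟩ := QuotientAddGroup.mk_out_eq_add C b
  refine ⟨(a, b), ?_⟩
  simp only [hc, hd, add_mul, mul_add, hC c c.2 b, hC c c.2 d, ← hC d d.2 a]
  abel

theorem finite_mul_commutators_mul {A : Type*} [Ring A]
    (h : {x : A | ∃ a b : A, x = a * b - b * a}.Finite) :
    (Set.univ * {x : A | ∃ a b : A, x = a * b - b * a} * Set.univ).Finite := by
  set K := {x : A | ∃ a b : A, x = a * b - b * a}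
  have hleft : (Set.univ * K).Finite := by
    have : Set.univ * K = ⋃ k ∈ K, Set.range (· * k) := by
      ext x
      simp only [Set.mem_mul, Set.mem_univ, true_and, Set.mem_iUnion, Set.mem_range, exists_prop]
      exact ⟨fun ⟨y, k, hk, e⟩ => ⟨k, hk, y, e⟩, fun ⟨k, hk, y, e⟩ => ⟨y, k, hk, e⟩⟩
    rw [this]
    refine h.biUnion ?_
    rintro _ ⟨a, b, rfl⟩
    refine (h.sub (h.image (· * a))).subset ?_
    rintro _ ⟨x, rfl⟩
    exact ⟨_, ⟨x * a, b, rfl⟩, _, ⟨_, ⟨x, b, rfl⟩, rfl⟩, by noncomm_ring⟩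
  refine (hleft.sub hleft).subset ?_
  rintro _ ⟨_, ⟨x, -, _, ⟨a, b, rfl⟩, rfl⟩, y, -, rfl⟩
  exact ⟨_, ⟨x, trivial, _, ⟨a, b * y, rfl⟩, rfl⟩, _, ⟨x * b, trivial, _, ⟨a, y, rfl⟩, rfl⟩,
    by noncomm_ring⟩

/-- In an additive commutative group, a finite set closed under integer multiples generates a
finite subgroup. -/
theorem AddSubgroup.finite_closure_of_zsmul_mem {A : Type*} [AddCommGroup A] {E : Set A}
    (hE : E.Finite) (hsmul : ∀ n : ℤ, ∀ x ∈ E, n • x ∈ E) :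
    (AddSubgroup.closure E : Set A).Finite := by
  have htors : ∀ x ∈ AddSubgroup.closure E, IsOfFinAddOrder x := by
    intro x hx
    induction hx using AddSubgroup.closure_induction with
    | mem x hx =>
      by_contra hinf
      exact Set.infinite_of_injective_forall_mem
        (injective_zsmul_iff_not_isOfFinAddOrder.mpr hinf) (fun n => hsmul n x hx) hE
    | zero => exact IsOfFinAddOrder.zero
    | add x y _ _ hx hy => exact hx.add hy
    | neg x _ hx => exact hx.neg
  have : AddGroup.FG (AddSubgroup.closure E) :=
    (AddGroup.fg_iff_addSubgroup_fg _).mpr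
      ((AddSubgroup.fg_iff _).mpr ⟨E, rfl, hE⟩)
  exact AddCommGroup.finite_of_fg_isAddTorsion (AddSubgroup.closure E) fun x =>
    (AddSubgroup.closure E).isOfFinAddOrder_coe.mp (htors x x.2)

theorem IsFutile.finite_commutatorIdeal {R A : Type*} [CommRing R] [Ring A] [Algebra R A]
    (hA : IsFutile R A) : (commutatorIdeal A : Set A).Finite := by
  obtain ⟨C, _, hC⟩ := hA.exists_finiteIndex_central
  have hE := finite_mul_commutators_mul (finite_commutators_of_finiteIndex_central C hC)
  refine (AddSubgroup.finite_closure_of_zsmul_mem hE ?_).subset fun x hx =>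
    TwoSidedIdeal.mem_span_iff_mem_addSubgroup_closure.mp hx
  rintro n _ ⟨z, hz, y, -, rfl⟩
  exact ⟨z, hz, n • y, trivial, mul_smul_comm n z y⟩

/-- `A` is a futile `R`-algebra if and only if `A/[A,A]` is a futile `R`-algebra and the
commutator ideal `[A,A]` is a finite set. -/
theorem isFutile_iff_quotient_commutatorIdeal_isFutile_and_finite
    {R A : Type*} [CommRing R] [Ring A] [Algebra R A] :
    IsFutile R A ↔
      IsFutile R (commutatorIdeal A).ringCon.Quotient ∧ (commutatorIdeal A : Set A).Finite := by
  let π : A →ₐ[R] (commutatorIdeal A).ringCon.Quotient :=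
    { RingCon.mk' (commutatorIdeal A).ringCon with commutes' := fun _ => rfl }
  have hπ : Function.Surjective π := RingCon.mk'_surjective _
  have hker : {x : A | π x = 0} = commutatorIdeal A := by
    ext x
    exact (RingCon.eq _).trans (TwoSidedIdeal.mem_iff _ _).symm
  exact ⟨fun hA => ⟨hA.of_surjective π hπ, hA.finite_commutatorIdeal⟩,
    fun ⟨hB, hfin⟩ => hB.of_finite_ker π (hker ▸ hfin)⟩
end

section
/- Let R be a commutative ring. The following statements are equivalent: (1) every R-futile R-algebra is monogenic over R; (2) every commutative R-futile R-algebra is monogenic over R; (3) every R-futile R-algebra is commutative; (4) for every prime ideal 𝔭 of R, the quotient ring R/𝔭 is infinite. -/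
universe u

/-- A finite algebra is futile. -/
theorem IsFutile.of_finite (R A : Type*) [CommRing R] [Ring A] [Algebra R A] [Finite A] :
    IsFutile R A :=
  Finite.of_injective (fun S : Subalgebra R A ↦ (S : Set A)) SetLike.coe_injective

/-- If all residue rings of `R` at primes are infinite, then no proper submodule of an `R`-module
has a finite quotient. -/
theorem Submodule.eq_top_of_finite_quotient {R M : Type*} [CommRing R] [AddCommGroup M]
    [Module R M] (hR : ∀ p : Ideal R, p.IsPrime → Infinite (R ⧸ p)) (N : Submodule R M)
    [Finite (M ⧸ N)] : N = ⊤ := by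
  by_contra hN
  obtain ⟨x, hx⟩ : ∃ x, x ∉ N := by
    contrapose! hN
    exact (Submodule.eq_top_iff').2 hN
  let f : R →ₗ[R] M ⧸ N := LinearMap.toSpanSingleton R (M ⧸ N) (N.mkQ x)
  have hf : LinearMap.ker f ≠ ⊤ := fun h ↦ hx <| by
    have h1 : (1 : R) ∈ LinearMap.ker f := h ▸ Submodule.mem_top
    simpa [f] using h1
  have : Finite (R ⧸ LinearMap.ker f) :=
    Finite.of_injective _ (LinearMap.ker_eq_bot.1 (Submodule.ker_liftQ_eq_bot' _ f rfl))
  obtain ⟨m, hm, hle⟩ := Ideal.exists_le_maximal (LinearMap.ker f) hf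
  have := Finite.of_surjective _ (Ideal.Quotient.factor_surjective hle)
  exact (hR m hm.isPrime).not_finite this

/-- Over a ring whose residue rings at primes are all infinite, futile algebras are monogenic. -/
theorem IsFutile.exists_adjoin_singleton_eq_top {R A : Type*} [CommRing R] [Ring A] [Algebra R A]
    (hR : ∀ p : Ideal R, p.IsPrime → Infinite (R ⧸ p)) (hA : IsFutile R A) :
    ∃ a : A, Algebra.adjoin R {a} = ⊤ := by
  classical
  have : Finite (Subalgebra R A) := hA
  have hfin : (Set.range fun a : A ↦ Algebra.adjoin R {a}).Finite := Set.toFinite _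
  obtain ⟨S, hS, hfi⟩ := Submodule.exists_finiteIndex_of_cover (s := hfin.toFinset)
    (p := fun S : Subalgebra R A ↦ Subalgebra.toSubmodule S) <| by
      refine Set.eq_univ_of_forall fun a ↦ Set.mem_biUnion (x := Algebra.adjoin R {a}) ?_ ?_
      · simp
      · exact Algebra.self_mem_adjoin_singleton R a
  obtain ⟨a, rfl⟩ := hfin.mem_toFinset.1 hS
  have : Finite (A ⧸ Subalgebra.toSubmodule (Algebra.adjoin R {a})) :=
    AddSubgroup.finite_quotient_of_finiteIndex
  exact ⟨a, Algebra.toSubmodule_eq_top.1 (Submodule.eq_top_of_finite_quotient hR _)⟩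

/-- A non-injective family `a : ι → K` does not generate the `R`-algebra `ι → K`. -/
theorem Pi.adjoin_singleton_ne_top {R K ι : Type*} [CommRing R] [CommRing K] [Nontrivial K]
    [Algebra R K] (a : ι → K) (ha : ¬ Function.Injective a) : Algebra.adjoin R {a} ≠ ⊤ := by
  classical
  intro h
  obtain ⟨i, j, hij, hne⟩ := Function.not_injective_iff.1 ha
  have hle : Algebra.adjoin R {a} ≤
      AlgHom.equalizer (Pi.evalAlgHom R (fun _ : ι ↦ K) i) (Pi.evalAlgHom R (fun _ : ι ↦ K) j) :=
    Algebra.adjoin_le (Set.singleton_subset_iff.2 hij)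
  have hs : (Pi.single i 1 : ι → K) i = (Pi.single i 1 : ι → K) j :=
    hle (h ▸ Algebra.mem_top : (Pi.single i 1 : ι → K) ∈ Algebra.adjoin R {a})
  simp [Pi.single_eq_of_ne hne.symm] at hs

/-- For a commutative ring `R` the following are equivalent:
(1) every futile `R`-algebra is monogenic;
(2) every commutative futile `R`-algebra is monogenic;
(3) every futile `R`-algebra is commutative;
(4) for every prime ideal `𝔭` of `R` the quotient `R/𝔭` is infinite. -/
theorem futile_monogenic_tfae (R : Type u) [CommRing R] :
    List.TFAE
      [ ∀ (A : Type u) [Ring A] [Algebra R A], IsFutile R A →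
          ∃ a : A, Algebra.adjoin R {a} = ⊤,
        ∀ (A : Type u) [CommRing A] [Algebra R A], IsFutile R A →
          ∃ a : A, Algebra.adjoin R {a} = ⊤,
        ∀ (A : Type u) [Ring A] [Algebra R A], IsFutile R A →
          ∀ x y : A, x * y = y * x,
        ∀ p : Ideal R, p.IsPrime → Infinite (R ⧸ p) ] := by
  tfae_have 4 → 1 := fun hR A _ _ hA ↦ hA.exists_adjoin_singleton_eq_top hR
  tfae_have 1 → 2 := fun h A _ _ hA ↦ h A hA
  tfae_have 1 → 3 := fun h A _ _ hA x y ↦ by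
    obtain ⟨a, ha⟩ := h A hA
    have hmem (z : A) : z ∈ Algebra.adjoin R {a} := ha ▸ Algebra.mem_top
    exact congrArg Subtype.val
      (mul_comm (⟨x, hmem x⟩ : Algebra.adjoin R {a}) ⟨y, hmem y⟩)
  tfae_have 2 → 4 := fun h p hp ↦ by
    by_contra hfin
    have : Finite (R ⧸ p) := not_infinite_iff_finite.1 hfin
    obtain ⟨a, ha⟩ := h (Option (R ⧸ p) → R ⧸ p) (IsFutile.of_finite R _)
    refine Pi.adjoin_singleton_ne_top a (fun hinj ↦ ?_) ha
    have := Nat.card_le_card_of_injective a hinj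
    rw [Finite.card_option] at this
    omega
  tfae_have 3 → 4 := fun h p hp ↦ by
    by_contra hfin
    have : Finite (R ⧸ p) := not_infinite_iff_finite.1 hfin
    have hcomm := h (Matrix (Fin 2) (Fin 2) (R ⧸ p)) (IsFutile.of_finite R _)
      !![0, 1; 0, 0] !![0, 0; 1, 0]
    simpa using congrFun₂ hcomm 0 0
  tfae_finish
end

section
/- Let L/K be an extension of fields, and let p be the characteristic of K if the characteristic is nonzero, and p = 1 otherwise. Then the following are equivalent: (1) L is a K-futile K-algebra; (2) [L:K] is finite and the degree [L : L^p K] of L over the subfield generated by K and the p-th powers of elements of L is 1 or p; (3) L = K[α] for some α ∈ L, i.e. the field extension is primitive. -/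
/-- The characteristic exponent of a field: its characteristic if that is nonzero,
and `1` otherwise. -/
noncomputable def charExponent (K : Type*) [Field K] : ℕ :=
  if ringChar K = 0 then 1 else ringChar K

open IntermediateField Polynomial

section

variable {K L : Type*} [Field K] [Field L] [Algebra K L]

instance expChar_charExponent : ExpChar K (charExponent K) := by
  have h : ringExpChar K = charExponent K := by
    rw [ringExpChar, charExponent]
    split_ifs with h0
    · simp [h0]
    · exact max_eq_left (Nat.one_le_iff_ne_zero.mpr h0)
  exact ringExpChar.of_eq h

/-- A field generated by one element as an algebra over a subfield is finite over it. -/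
lemma finiteDimensional_of_adjoin_singleton_eq_top {α : L} (h : Algebra.adjoin K {α} = ⊤) :
    FiniteDimensional K L := by
  have : Algebra.FiniteType K L := ⟨⟨{α}, by simpa using h⟩⟩
  exact finite_of_finite_type_of_isJacobsonRing K L

lemma algebraAdjoin_singleton_eq_top_iff [Algebra.IsAlgebraic K L] {α : L} :
    Algebra.adjoin K {α} = ⊤ ↔ K⟮α⟯ = ⊤ := by
  rw [← adjoin_simple_toSubalgebra_of_isAlgebraic (Algebra.IsAlgebraic.isAlgebraic α),
    ← IntermediateField.top_toSubalgebra, IntermediateField.toSubalgebra_inj]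

/-- Adjoining a `p`-th root, `p` the characteristic exponent, has degree `1` or `p`. -/
lemma finrank_adjoin_simple_of_pow_mem (p : ℕ) [ExpChar K p] {α : L} {a : K}
    (h : α ^ p = algebraMap K L a) :
    Module.finrank K K⟮α⟯ = 1 ∨ Module.finrank K K⟮α⟯ = p := by
  have := expChar_of_injective_algebraMap (algebraMap K L).injective p
  by_cases hb : ∃ b : K, b ^ p = a
  · obtain ⟨b, rfl⟩ := hb
    left
    have hα : α = algebraMap K L b := frobenius_inj L p (by simpa [frobenius_def] using h)
    rw [IntermediateField.finrank_adjoin_simple_eq_one_iff, hα]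
    exact IntermediateField.algebraMap_mem ⊥ b
  · right
    push Not at hb
    rcases expChar_is_prime_or_one K p with hp | rfl
    · have hirr := X_pow_sub_C_irreducible_of_prime hp hb
      have hmin : X ^ p - C a = minpoly K α :=
        minpoly.eq_of_irreducible_of_monic hirr (by simp [h]) (monic_X_pow_sub_C a hp.ne_zero)
      have hint : IsIntegral K α := ⟨X ^ p - C a, monic_X_pow_sub_C a hp.ne_zero, by simp [h]⟩
      rw [adjoin.finrank hint, ← hmin, natDegree_X_pow_sub_C]
    · exact absurd (pow_one a) (hb a)

lemma finrank_adjoin_range_pow_of_adjoin_simple_eq_top (p : ℕ) [ExpChar K p] {α : L}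
    (h : K⟮α⟯ = ⊤) :
    Module.finrank (adjoin K (Set.range fun y : L => y ^ p)) L = 1 ∨
      Module.finrank (adjoin K (Set.range fun y : L => y ^ p)) L = p := by
  set M := adjoin K (Set.range fun y : L => y ^ p)
  have : ExpChar M p := expChar_of_injective_algebraMap (algebraMap K M).injective p
  have htop : M⟮α⟯ = ⊤ := by
    rw [← restrictScalars_eq_top_iff (K := K), eq_top_iff, ← h, adjoin_simple_le_iff]
    exact mem_adjoin_simple_self M α
  have := finrank_adjoin_simple_of_pow_mem (K := M) p (α := α)
    (a := ⟨α ^ p, subset_adjoin K _ ⟨α, rfl⟩⟩) rfl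
  rwa [htop, finrank_top'] at this

/-- If `[L : LᵖK]` is `1` or `p`, then one element generates `L` over `LᵖK`. -/
lemma exists_adjoin_insert_range_pow_eq_top (p : ℕ) [ExpChar K p] [FiniteDimensional K L]
    (h : Module.finrank (adjoin K (Set.range fun y : L => y ^ p)) L = 1 ∨
      Module.finrank (adjoin K (Set.range fun y : L => y ^ p)) L = p) :
    ∃ α : L, adjoin K (insert α (Set.range fun y : L => y ^ p)) = ⊤ := by
  have key (α : L) : adjoin K (insert α (Set.range fun y : L => y ^ p)) =
      (adjoin K (Set.range fun y : L => y ^ p))⟮α⟯.restrictScalars K := by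
    rw [adjoin_adjoin_left, Set.union_singleton]
  simp_rw [key, restrictScalars_eq_top_iff]
  set M := adjoin K (Set.range fun y : L => y ^ p)
  have : ExpChar M p := expChar_of_injective_algebraMap (algebraMap K M).injective p
  by_cases h1 : Module.finrank M L = 1
  · refine ⟨0, ?_⟩
    have := IntermediateField.bot_eq_top_of_finrank_adjoin_eq_one (F := M) (E := L)
      fun x => Nat.eq_one_of_dvd_one (h1 ▸ ⟨_, (Module.finrank_mul_finrank M M⟮x⟯ L).symm⟩)
    rw [eq_top_iff, ← this]
    exact bot_le
  · have hp := h.resolve_left h1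
    obtain ⟨α, hα⟩ : ∃ α : L, Module.finrank M M⟮α⟯ ≠ 1 := by
      by_contra! hall
      have := IntermediateField.bot_eq_top_of_finrank_adjoin_eq_one (F := M) (E := L) hall
      apply h1
      rw [← finrank_top' (F := M) (E := L), ← this, IntermediateField.finrank_bot]
    refine ⟨α, ?_⟩
    have := (finrank_adjoin_simple_of_pow_mem (K := M) p (α := α)
      (a := ⟨α ^ p, subset_adjoin K _ ⟨α, rfl⟩⟩) rfl).resolve_left hα
    refine IntermediateField.eq_of_le_of_finrank_eq le_top ?_
    rw [this, finrank_top', hp]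

/-- If `L` is generated by `α` over `LᵖK`, then it is so over every `L^(pⁿ)K`. -/
lemma adjoin_insert_range_pow_pow_eq_top (p : ℕ) [ExpChar K p] {α : L}
    (h : adjoin K (insert α (Set.range fun y : L => y ^ p)) = ⊤) (n : ℕ) :
    adjoin K (insert α (Set.range fun y : L => y ^ p ^ n)) = ⊤ := by
  have := expChar_of_injective_algebraMap (algebraMap K L).injective p
  induction n with
  | zero => exact eq_top_iff.mpr fun y _ => subset_adjoin K _ (Or.inr ⟨y, by simp⟩)
  | succ n ih =>
    rw [eq_top_iff, ← ih, adjoin_le_iff]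
    set F := adjoin K (insert α (Set.range fun y : L => y ^ p ^ (n + 1)))
    have hα : α ∈ F := subset_adjoin K _ (Set.mem_insert _ _)
    rintro _ (rfl | ⟨y, rfl⟩)
    · exact hα
    have hy : y ∈ adjoin K (insert α (Set.range fun y : L => y ^ p)) := h ▸ mem_top
    change y ^ p ^ n ∈ F
    induction hy using adjoin_induction with
    | mem x hx =>
      rcases hx with rfl | ⟨z, rfl⟩
      · exact pow_mem hα _
      · exact subset_adjoin K _ (Or.inr ⟨z, by simp [pow_succ', pow_mul]⟩)
    | algebraMap x => exact pow_mem (F.algebraMap_mem x) _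
    | add x y _ _ hx hy => rw [add_pow_expChar_pow]; exact add_mem hx hy
    | inv x _ hx => rw [inv_pow]; exact inv_mem hx
    | mul x y _ _ hx hy => rw [mul_pow]; exact mul_mem hx hy

/-- A primitive element theorem for one separable generator `β` and a generator `α` with a
separable `pⁿ`-th power. -/
lemma exists_adjoin_simple_eq_adjoin_pair (p n : ℕ) [ExpChar K p] [Infinite K]
    [FiniteDimensional K L] {α β : L} (hβ : IsSeparable K β)
    (hα : IsSeparable K (α ^ p ^ n)) : ∃ γ : L, K⟮γ⟯ = K⟮α, β⟯ := by
  have := expChar_of_injective_algebraMap (algebraMap K L).injective p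
  let S := separableClosure K L
  have hmem (c : K) : (α + algebraMap K L c * β) ^ p ^ n ∈ S := by
    rw [add_pow_expChar_pow]
    exact add_mem (mem_separableClosure_iff.mpr hα)
      (pow_mem (mul_mem (S.algebraMap_mem c) (mem_separableClosure_iff.mpr hβ)) _)
  have : Finite (IntermediateField K S) :=
    (Field.exists_primitive_element_iff_finite_intermediateField K S).mp
      ⟨inferInstance, Field.exists_primitive_element K S⟩
  obtain ⟨c, d, hcd, heq⟩ := Finite.exists_ne_map_eq_of_infinite
    fun c : K => K⟮(⟨_, hmem c⟩ : S)⟯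
  replace heq : K⟮(α + algebraMap K L c * β) ^ p ^ n⟯ = K⟮(α + algebraMap K L d * β) ^ p ^ n⟯ := by
    simpa only [lift_adjoin_simple] using congr_arg lift heq
  set γ := α + algebraMap K L c * β
  have hβpow : β ^ p ^ n ∈ K⟮γ ^ p ^ n⟯ := by
    have hd : (α + algebraMap K L d * β) ^ p ^ n ∈ K⟮γ ^ p ^ n⟯ :=
      heq ▸ mem_adjoin_simple_self K _
    have hsub := sub_mem (mem_adjoin_simple_self K (γ ^ p ^ n)) hd
    have hne : algebraMap K L ((c - d) ^ p ^ n) ≠ 0 :=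
      (_root_.map_ne_zero _).mpr (pow_ne_zero _ (sub_ne_zero.mpr hcd))
    have hexp : γ ^ p ^ n - (α + algebraMap K L d * β) ^ p ^ n =
        algebraMap K L ((c - d) ^ p ^ n) * β ^ p ^ n := by
      rw [← sub_pow_expChar_pow, map_pow, ← mul_pow, map_sub]
      ring
    rw [hexp] at hsub
    have := mul_mem (inv_mem (K⟮γ ^ p ^ n⟯.algebraMap_mem ((c - d) ^ p ^ n))) hsub
    rwa [inv_mul_cancel_left₀ hne] at this
  have hβγ : β ∈ K⟮γ⟯ := by
    have hle : K⟮β⟯ ≤ K⟮γ⟯ := by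
      rw [adjoin_simple_eq_adjoin_pow_expChar_pow_of_isSeparable K L hβ p n, adjoin_simple_le_iff]
      exact adjoin_simple_le_iff.mpr (pow_mem (mem_adjoin_simple_self K γ) _) hβpow
    exact hle (mem_adjoin_simple_self K β)
  have hαγ : α ∈ K⟮γ⟯ := by
    have := sub_mem (mem_adjoin_simple_self K γ) (mul_mem (K⟮γ⟯.algebraMap_mem c) hβγ)
    rwa [add_sub_cancel_right] at this
  refine ⟨γ, le_antisymm (adjoin_simple_le_iff.mpr ?_) (adjoin_le_iff.mpr ?_)⟩
  · exact add_mem (subset_adjoin K _ (by simp))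
      (mul_mem (IntermediateField.algebraMap_mem _ c) (subset_adjoin K _ (by simp)))
  · rintro _ (rfl | rfl)
    exacts [hαγ, hβγ]

lemma exists_adjoin_simple_eq_top_of_finrank (p : ℕ) [ExpChar K p] [FiniteDimensional K L]
    (h : Module.finrank (adjoin K (Set.range fun y : L => y ^ p)) L = 1 ∨
      Module.finrank (adjoin K (Set.range fun y : L => y ^ p)) L = p) :
    ∃ α : L, K⟮α⟯ = ⊤ := by
  cases finite_or_infinite K
  · exact Field.exists_primitive_element_of_finite_bot K L
  obtain ⟨α, hα⟩ := exists_adjoin_insert_range_pow_eq_top p h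
  let S := separableClosure K L
  have : ExpChar S p := expChar_of_injective_algebraMap (algebraMap K S).injective p
  have : IsPurelyInseparable S L := separableClosure.isPurelyInseparable K L
  obtain ⟨n, hn⟩ := (IsPurelyInseparable.hasExponent_iff' S L p).mp inferInstance
  have hpow (y : L) : y ^ p ^ n ∈ S := by
    obtain ⟨s, hs⟩ := hn y
    exact hs ▸ s.2
  obtain ⟨b, hb⟩ := Field.exists_primitive_element K S
  have hS : K⟮(b : L)⟯ = S := by
    simpa only [lift_adjoin_simple, lift_top] using congr_arg lift hb
  obtain ⟨γ, hγ⟩ := exists_adjoin_simple_eq_adjoin_pair p n (α := α) (β := (b : L))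
    (mem_separableClosure_iff.mp b.2) (mem_separableClosure_iff.mp (hpow α))
  refine ⟨γ, ?_⟩
  rw [hγ, eq_top_iff, ← adjoin_insert_range_pow_pow_eq_top p hα n, adjoin_le_iff]
  rintro _ (rfl | ⟨y, rfl⟩)
  · exact subset_adjoin K _ (by simp)
  · have hle : K⟮(b : L)⟯ ≤ K⟮α, (b : L)⟯ := adjoin.mono K _ _ (by simp)
    exact hle (hS.ge (hpow y))

lemma isFutile_iff_exists_adjoin_singleton_eq_top :
    IsFutile K L ↔ ∃ α : L, Algebra.adjoin K {α} = ⊤ := by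
  constructor
  · intro h
    have : Finite (Subalgebra K L) := h
    have : Finite (IntermediateField K L) :=
      Finite.of_injective _ IntermediateField.toSubalgebra_injective
    have := Field.isAlgebraic_of_finite_intermediateField K L
    simp_rw [algebraAdjoin_singleton_eq_top_iff]
    exact Field.exists_primitive_element_of_finite_intermediateField K L ⊤
  · rintro ⟨α, hα⟩
    have := finiteDimensional_of_adjoin_singleton_eq_top hα
    have := Field.finite_intermediateField_of_exists_primitive_element K L
      ⟨α, algebraAdjoin_singleton_eq_top_iff.mp hα⟩
    exact Finite.of_equiv _ (subalgebraEquivIntermediateField (K := K) (L := L)).symm.toEquiv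

end

/-- Let `L/K` be an extension of fields and `p` the characteristic exponent of `K`.
The following are equivalent: (1) `L` is a futile `K`-algebra; (2) `[L:K] < ∞` and
`[L : LᵖK] ∈ {1, p}`; (3) `L = K[α]` for some `α ∈ L`. -/
theorem field_extension_futile_tfae (K L : Type*) [Field K] [Field L] [Algebra K L] :
    List.TFAE
      [ IsFutile K L,
        FiniteDimensional K L ∧
          (Module.finrank
              (IntermediateField.adjoin K (Set.range fun y : L => y ^ charExponent K)) L = 1 ∨
           Module.finrank
              (IntermediateField.adjoin K (Set.range fun y : L => y ^ charExponent K)) L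
              = charExponent K),
        ∃ α : L, Algebra.adjoin K {α} = ⊤ ] := by
  tfae_have 1 ↔ 3 := isFutile_iff_exists_adjoin_singleton_eq_top
  tfae_have 3 → 2 := by
    rintro ⟨α, hα⟩
    have := finiteDimensional_of_adjoin_singleton_eq_top hα
    exact ⟨this, finrank_adjoin_range_pow_of_adjoin_simple_eq_top _
      (algebraAdjoin_singleton_eq_top_iff.mp hα)⟩
  tfae_have 2 → 3 := by
    rintro ⟨_, h⟩
    simp_rw [algebraAdjoin_singleton_eq_top_iff]
    exact exists_adjoin_simple_eq_top_of_finrank _ h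
  tfae_finish
end

section
/- Let R be a principal ideal domain which is not a field, such that R/𝔭 is finite for every nonzero prime ideal 𝔭 of R. Then an R-algebra A is R-futile if and only if one of the following holds: (1) A is a finite set; (2) the R-torsion submodule A_tor = {a ∈ A : ∃ r ∈ R \ {0}, ra = 0} is finite, and A/A_tor is isomorphic as an R-algebra to the subalgebra R[1/r] of the fraction field Q(R) for some r ∈ R \ {0}. -/
open Polynomial Pointwise

section Futile

variable {R A : Type*} [CommRing R] [Ring A] [Algebra R A]

/-- The subalgebra `R + cS` of a subalgebra `S`. -/
def Subalgebra.baseAddSMul (S : Subalgebra R A) (c : R) : Subalgebra R A where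
  carrier := {x | ∃ r : R, ∃ m ∈ S, x = algebraMap R A r + c • m}
  algebraMap_mem' r := ⟨r, 0, S.zero_mem, by simp⟩
  add_mem' := by
    rintro _ _ ⟨r, m, hm, rfl⟩ ⟨r', m', hm', rfl⟩
    exact ⟨r + r', m + m', S.add_mem hm hm', by simp only [map_add, smul_add]; abel⟩
  mul_mem' := by
    rintro _ _ ⟨r, m, hm, rfl⟩ ⟨r', m', hm', rfl⟩
    refine ⟨r * r', r • m' + r' • m + c • (m * m'), ?_, ?_⟩
    · exact S.add_mem (S.add_mem (S.smul_mem hm' r) (S.smul_mem hm r'))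
        (S.smul_mem (S.mul_mem hm hm') c)
    · simp only [Algebra.algebraMap_eq_smul_one, add_mul, mul_add, smul_mul_smul_comm, mul_one,
        one_mul, smul_add, smul_smul, mul_comm c r]
      abel

/-- A sequence of subalgebras of a futile algebra repeats itself. -/
theorem IsFutile.exists_lt_eq (hA : IsFutile R A) (f : ℕ → Subalgebra R A) :
    ∃ m n, m < n ∧ f m = f n := by
  have : Finite (Subalgebra R A) := hA
  obtain ⟨m, n, hmn, h⟩ := Finite.exists_ne_map_eq_of_infinite f
  rcases hmn.lt_or_gt with hlt | hlt
  · exact ⟨m, n, hlt, h⟩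
  · exact ⟨n, m, hlt, h.symm⟩

variable [IsDomain R]

/-- An integral element of a futile algebra has a nonzero multiple in the base ring. -/
theorem IsFutile.exists_smul_eq_algebraMap_of_isIntegral (hA : IsFutile R A) {p : R} (hp0 : p ≠ 0)
    (hp : ¬ IsUnit p) {y : A} (hy : IsIntegral R y) :
    ∃ s : R, s ≠ 0 ∧ ∃ r : R, s • y = algebraMap R A r := by
  set S := Algebra.adjoin R {y}
  obtain ⟨m, n, hmn, h⟩ := hA.exists_lt_eq fun n => S.baseAddSMul (p ^ n)
  obtain ⟨k, rfl⟩ := Nat.exists_eq_add_of_lt hmn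
  let N : Submodule R (A ⧸ (1 : Submodule R A)) :=
    (Subalgebra.toSubmodule S).map (p ^ m • (1 : Submodule R A).mkQ)
  have hN : N.FG := hy.fg_adjoin_singleton.map _
  have hle : N ≤ Ideal.span {p} • N := by
    rintro _ ⟨z, hz, rfl⟩
    have hz' : p ^ m • z ∈ S.baseAddSMul (p ^ m) := ⟨0, z, hz, by simp⟩
    rw [h] at hz'
    obtain ⟨r, w, hw, hzw⟩ := hz'
    have h1 : (1 : Submodule R A).mkQ (algebraMap R A r) = 0 := by
      rw [Submodule.mkQ_apply, Submodule.Quotient.mk_eq_zero]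
      exact Submodule.algebraMap_mem r
    have h2 : (p ^ m • (1 : Submodule R A).mkQ) z
        = p • (p ^ m • (1 : Submodule R A).mkQ) (p ^ k • w) := by
      rw [LinearMap.smul_apply, ← map_smul, hzw, map_add, h1, zero_add, LinearMap.smul_apply,
        ← map_smul, ← map_smul, smul_smul, smul_smul]
      congr 2
      ring
    rw [h2]
    exact Submodule.smul_mem_smul (Ideal.mem_span_singleton_self p)
      ⟨p ^ k • w, S.smul_mem hw _, rfl⟩
  obtain ⟨e, he, heN⟩ := Submodule.exists_sub_one_mem_and_smul_eq_zero_of_fg_of_le_smul _ N hN hle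
  have he0 : e ≠ 0 := by
    rintro rfl
    rw [Ideal.mem_span_singleton, zero_sub, dvd_neg] at he
    exact hp (isUnit_of_dvd_one he)
  have := heN _ ⟨y, Algebra.self_mem_adjoin_singleton R y, rfl⟩
  rw [LinearMap.smul_apply, smul_smul, ← map_smul, Submodule.mkQ_apply,
    Submodule.Quotient.mk_eq_zero, Submodule.mem_one] at this
  obtain ⟨r, hr⟩ := this
  exact ⟨e * p ^ m, mul_ne_zero he0 (pow_ne_zero _ hp0), r, hr.symm⟩

/-- Every element of a futile algebra has a nonzero multiple in the base ring. -/
theorem IsFutile.exists_smul_eq_algebraMap (hA : IsFutile R A) (hR : ¬ IsField R) (x : A) :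
    ∃ s : R, s ≠ 0 ∧ ∃ r : R, s • x = algebraMap R A r := by
  obtain ⟨p, hp0, hp⟩ := Ring.exists_not_isUnit_of_not_isField hR
  obtain ⟨m, n, hmn, h⟩ := hA.exists_lt_eq fun n => Algebra.adjoin R {p ^ n • x}
  obtain ⟨k, rfl⟩ := Nat.exists_eq_add_of_lt hmn
  have hmem : p ^ m • x ∈ Algebra.adjoin R {p ^ (m + k + 1) • x} :=
    h ▸ Algebra.self_mem_adjoin_singleton R _
  rw [Algebra.adjoin_singleton_eq_range_aeval] at hmem
  obtain ⟨F, hF⟩ := hmem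
  have halg : IsAlgebraic R (p ^ m • x) := by
    refine ⟨F.comp (C (p ^ (k + 1)) * X) - X, fun h0 => hp ?_, ?_⟩
    · have h1 := congrArg (coeff · 1) h0
      simp only [coeff_sub, comp_C_mul_X_coeff, coeff_X_one, coeff_zero, sub_eq_zero] at h1
      exact isUnit_of_dvd_one ⟨F.coeff 1 * p ^ k, by rw [← h1]; ring⟩
    · rw [map_sub, aeval_comp, aeval_X, map_mul, aeval_C, aeval_X, ← Algebra.smul_def, smul_smul,
        ← pow_add, sub_eq_zero, ← hF]
      congr 4
      ring
  obtain ⟨s, hs, hint⟩ := halg.exists_integral_multiple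
  obtain ⟨t, ht, r, hr⟩ := hA.exists_smul_eq_algebraMap_of_isIntegral hp0 hp hint
  refine ⟨t * s * p ^ m, mul_ne_zero (mul_ne_zero ht hs) (pow_ne_zero _ hp0), r, ?_⟩
  rw [← hr, smul_smul, smul_smul]

/-- Every element of a futile algebra is integral modulo each maximal principal ideal. -/
theorem IsFutile.exists_monic_aeval_eq_smul_of_prime [IsPrincipalIdealRing R] (hA : IsFutile R A)
    {p : R} (hp : Prime p) (t : A) :
    ∃ g h : R[X], g.Monic ∧ aeval t g = p • aeval t h := by
  obtain ⟨m, n, hmn, h⟩ := hA.exists_lt_eq fun n => Algebra.adjoin R {t ^ 2 ^ n}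
  obtain ⟨k, rfl⟩ := Nat.exists_eq_add_of_lt hmn
  have hmem : t ^ 2 ^ m ∈ Algebra.adjoin R {t ^ 2 ^ (m + k + 1)} :=
    h ▸ Algebra.self_mem_adjoin_singleton R _
  rw [Algebra.adjoin_singleton_eq_range_aeval] at hmem
  obtain ⟨F, hF⟩ := hmem
  have hmax : (Ideal.span {p}).IsMaximal := PrincipalIdealRing.isMaximal_of_irreducible
    hp.irreducible
  let : Field (R ⧸ Ideal.span {p}) := Ideal.Quotient.field _
  let π := Ideal.Quotient.mk (Ideal.span {p})
  let G : R[X] := expand R (2 ^ (k + 1)) F - X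
  have hG : aeval (t ^ 2 ^ m) G = 0 := by
    rw [map_sub, expand_aeval, aeval_X, ← pow_mul, ← pow_add, sub_eq_zero, ← hF]
    congr 4
  have hG0 : G.map π ≠ 0 := by
    intro h0
    have h1 := congrArg (coeff · 1) h0
    have h2 : ¬ 2 ^ (k + 1) ∣ 1 := by
      rw [Nat.dvd_one]
      exact (Nat.one_lt_two_pow (Nat.succ_ne_zero k)).ne'
    simp [G, coeff_map, coeff_expand (pow_pos two_pos (k + 1)), h2] at h1
  obtain ⟨c, hc⟩ := Ideal.Quotient.mk_surjective (G.map π).leadingCoeff⁻¹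
  have hmap : (C c * G).map π = G.map π * C (G.map π).leadingCoeff⁻¹ := by
    rw [Polynomial.map_mul, map_C, mul_comm]
    exact congrArg (fun a => G.map π * C a) hc
  obtain ⟨g, hg, -, hgm⟩ := lifts_and_natDegree_eq_and_monic (f := π)
    (p := (C c * G).map π) ⟨C c * G, rfl⟩ (by
      rw [hmap]; exact monic_mul_leadingCoeff_inv hG0)
  have hdvd : C p ∣ g - C c * G := by
    rw [C_dvd_iff_dvd_coeff]
    intro i
    rw [← Ideal.mem_span_singleton, ← Ideal.Quotient.eq_zero_iff_mem, ← coeff_map,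
      Polynomial.map_sub]
    exact (by rw [hg, sub_self, coeff_zero] : (g.map π - (C c * G).map π).coeff i = 0)
  obtain ⟨H, hH⟩ := hdvd
  refine ⟨expand R (2 ^ m) g, expand R (2 ^ m) H, hgm.expand (pow_pos two_pos m), ?_⟩
  rw [expand_aeval, expand_aeval, sub_eq_iff_eq_add.1 hH, map_add, map_mul, map_mul, hG, mul_zero,
    add_zero, aeval_C, Algebra.smul_def]

/-- Every element of a futile algebra is integral modulo each nonzero principal ideal. -/
theorem IsFutile.exists_monic_aeval_eq_smul [IsPrincipalIdealRing R] (hA : IsFutile R A)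
    {s : R} (hs : s ≠ 0) (t : A) :
    ∃ g h : R[X], g.Monic ∧ aeval t g = s • aeval t h := by
  induction s using UniqueFactorizationMonoid.induction_on_prime with
  | h₁ => exact absurd rfl hs
  | h₂ u hu =>
    obtain ⟨v, rfl⟩ := hu
    exact ⟨1, C (↑v⁻¹ : R), monic_one, by
      rw [map_one, aeval_C, Algebra.smul_def, ← map_mul, Units.mul_inv, map_one]⟩
  | h₃ a p ha hp ih =>
    obtain ⟨g, h, hg, hgh⟩ := ih ha
    obtain ⟨g', h', hg', hgh'⟩ := hA.exists_monic_aeval_eq_smul_of_prime hp t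
    exact ⟨g' * g, h' * h, hg'.mul hg, by
      rw [map_mul, map_mul, hgh, hgh', smul_mul_smul_comm]⟩

/-- The torsion elements of a futile algebra are integral. -/
theorem IsFutile.isIntegral_of_smul_eq_zero [IsPrincipalIdealRing R] (hA : IsFutile R A)
    {s : R} (hs : s ≠ 0) {t : A} (ht : s • t = 0) : IsIntegral R t := by
  obtain ⟨g, h, hg, hgh⟩ := hA.exists_monic_aeval_eq_smul hs t
  refine ⟨g * X, hg.mul monic_X, ?_⟩
  rw [← aeval_def, map_mul, aeval_X, hgh, smul_mul_assoc, ← mul_smul_comm, ht, mul_zero]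

theorem finite_quotient_span_singleton [IsPrincipalIdealRing R]
    (hres : ∀ p : Ideal R, p ≠ ⊥ → p.IsPrime → Finite (R ⧸ p)) {s : R} (hs : s ≠ 0) :
    Finite (R ⧸ Ideal.span {s}) := by
  induction s using UniqueFactorizationMonoid.induction_on_prime with
  | h₁ => exact absurd rfl hs
  | h₂ u hu =>
    rw [Ideal.span_singleton_eq_top.2 hu]
    infer_instance
  | h₃ a p ha hp ih =>
    have := ih ha
    have : Finite (R ⧸ Ideal.span {p}) := hres _ (by simpa using hp.ne_zero)
      ((Ideal.span_singleton_prime hp.ne_zero).2 hp)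
    refine Finite.of_surjective (fun x : (R ⧸ Ideal.span {p}) × (R ⧸ Ideal.span {a}) =>
      Ideal.Quotient.mk (Ideal.span {p * a}) (x.1.out + p * x.2.out)) fun z => ?_
    have key (b x : R) : ∃ y, x = (Ideal.Quotient.mk (Ideal.span {b}) x).out + b * y := by
      obtain ⟨y, hy⟩ := Ideal.mem_span_singleton.1 (Ideal.Quotient.eq.1
        (Ideal.Quotient.mk_out (Ideal.Quotient.mk (Ideal.span {b}) x)).symm)
      exact ⟨y, by rw [← hy]; ring⟩
    obtain ⟨x, rfl⟩ := Ideal.Quotient.mk_surjective z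
    obtain ⟨y, hy⟩ := key p x
    obtain ⟨w, hw⟩ := key a y
    refine ⟨(Ideal.Quotient.mk _ x, Ideal.Quotient.mk _ y), ?_⟩
    rw [Ideal.Quotient.eq, Ideal.mem_span_singleton]
    exact ⟨-w, by linear_combination -hy - p * hw⟩

/-- A finitely generated torsion module is finite if all residue fields are. -/
theorem Submodule.FG.finite_of_isTorsion [IsPrincipalIdealRing R]
    (hres : ∀ p : Ideal R, p ≠ ⊥ → p.IsPrime → Finite (R ⧸ p))
    {M : Type*} [AddCommGroup M] [Module R M] {N : Submodule R M} (hN : N.FG)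
    (htors : ∀ x ∈ N, ∃ s : R, s ≠ 0 ∧ s • x = 0) : (N : Set M).Finite := by
  induction N, hN using Submodule.fg_induction with
  | singleton x =>
    obtain ⟨s, hs, hsx⟩ := htors x (Submodule.mem_span_singleton_self x)
    have := finite_quotient_span_singleton hres hs
    refine (Set.finite_range fun a : R ⧸ Ideal.span {s} => a.out • x).subset fun y hy => ?_
    obtain ⟨r, rfl⟩ := Submodule.mem_span_singleton.1 hy
    refine ⟨Ideal.Quotient.mk _ r, ?_⟩
    obtain ⟨c, hc⟩ := Ideal.mem_span_singleton.1 (Ideal.Quotient.eq.1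
      (Ideal.Quotient.mk_out (Ideal.Quotient.mk (Ideal.span {s}) r)))
    change (Ideal.Quotient.mk (Ideal.span {s}) r).out • x = r • x
    rw [← sub_eq_zero, ← sub_smul, hc, mul_comm, mul_smul, hsx, smul_zero]
  | sup N₁ N₂ hN₁ hN₂ h₁ h₂ =>
    rw [Submodule.coe_sup]
    exact (h₁ fun x hx => htors x (Submodule.mem_sup_left hx)).add
      (h₂ fun x hx => htors x (Submodule.mem_sup_right hx))

/-- The torsion of a futile algebra is finite. -/
theorem IsFutile.finite_torsion [IsPrincipalIdealRing R]
    (hres : ∀ p : Ideal R, p ≠ ⊥ → p.IsPrime → Finite (R ⧸ p)) (hA : IsFutile R A) :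
    {a : A | ∃ r : R, r ≠ 0 ∧ r • a = 0}.Finite := by
  have : Finite (Subalgebra R A) := hA
  let T : Submodule R A := Submodule.torsion R A
  have hT {a : A} : a ∈ T ↔ ∃ r : R, r ≠ 0 ∧ r • a = 0 := by
    rw [Submodule.mem_torsion_iff]
    exact ⟨fun ⟨r, hr⟩ => ⟨r, nonZeroDivisors.ne_zero r.2, hr⟩,
      fun ⟨r, h0, hr⟩ => ⟨⟨r, mem_nonZeroDivisors_of_ne_zero h0⟩, hr⟩⟩
  have hfin : (⋃ S ∈ {S : Subalgebra R A | (Subalgebra.toSubmodule S).FG},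
      ((Subalgebra.toSubmodule S ⊓ T : Submodule R A) : Set A)).Finite := by
    refine (Set.toFinite _).biUnion fun S hS => Submodule.FG.finite_of_isTorsion hres ?_
      fun x hx => hT.1 hx.2
    have := isNoetherian_of_fg_of_noetherian _ hS
    exact Submodule.FG.of_le hS inf_le_left
  refine hfin.subset fun t ht => ?_
  obtain ⟨s, hs, hst⟩ := ht
  exact Set.mem_biUnion (x := Algebra.adjoin R {t})
    (hA.isIntegral_of_smul_eq_zero hs hst).fg_adjoin_singleton
    ⟨Algebra.self_mem_adjoin_singleton R t, hT.2 ⟨s, hs, hst⟩⟩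

end Futile

section FractionField

variable {R K : Type*} [CommRing R] [Field K] [Algebra R K] [IsFractionRing R K]

theorem Subalgebra.inv_algebraMap_mem_of_dvd {S : Subalgebra R K} {u v : R} (huv : u ∣ v)
    (hv : v ≠ 0) (h : (algebraMap R K v)⁻¹ ∈ S) : (algebraMap R K u)⁻¹ ∈ S := by
  obtain ⟨c, rfl⟩ := huv
  have hc : algebraMap R K c ≠ 0 := by simpa using right_ne_zero_of_mul hv
  have : (algebraMap R K u)⁻¹ = c • (algebraMap R K (u * c))⁻¹ := by
    rw [Algebra.smul_def, map_mul, mul_inv, mul_left_comm, mul_inv_cancel₀ hc, mul_one]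
  rw [this]
  exact S.smul_mem h c

theorem exists_pow_smul_eq_algebraMap_of_mem_adjoin_inv {r : R} (hr : r ≠ 0) {x : K}
    (hx : x ∈ Algebra.adjoin R {(algebraMap R K r)⁻¹}) :
    ∃ (n : ℕ) (c : R), r ^ n • x = algebraMap R K c := by
  have hrK : algebraMap R K r ≠ 0 := by simpa using hr
  induction hx using Algebra.adjoin_induction with
  | mem x hx =>
    obtain rfl := hx
    exact ⟨1, 1, by rw [Algebra.smul_def, pow_one, mul_inv_cancel₀ hrK, map_one]⟩
  | algebraMap c => exact ⟨0, c, by simp⟩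
  | add x y _ _ hx hy =>
    obtain ⟨m, c, hc⟩ := hx
    obtain ⟨n, d, hd⟩ := hy
    refine ⟨m + n, r ^ n * c + r ^ m * d, ?_⟩
    rw [map_add, map_mul, map_mul, ← hc, ← hd]
    simp only [Algebra.smul_def, map_pow]
    ring
  | mul x y _ _ hx hy =>
    obtain ⟨m, c, hc⟩ := hx
    obtain ⟨n, d, hd⟩ := hy
    exact ⟨m + n, c * d, by rw [map_mul, ← hc, ← hd, smul_mul_smul_comm, pow_add]⟩

variable [IsDomain R]

/-- Over a principal ideal domain, each subalgebra of the fraction field contains the inverses of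
the reduced denominators of its elements. -/
theorem Subalgebra.exists_isCoprime_smul_inv_eq [IsPrincipalIdealRing R] {S : Subalgebra R K}
    {x : K} (hx : x ∈ S) :
    ∃ a b : R, b ≠ 0 ∧ IsCoprime a b ∧ x = a • (algebraMap R K b)⁻¹ ∧
      (algebraMap R K b)⁻¹ ∈ S := by
  have hb : (IsFractionRing.den R x : R) ≠ 0 := nonZeroDivisors.ne_zero (IsFractionRing.den R x).2
  have hbK : algebraMap R K (IsFractionRing.den R x) ≠ 0 := by simp
  have hxab : x = IsFractionRing.num R x • (algebraMap R K (IsFractionRing.den R x))⁻¹ := by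
    rw [Algebra.smul_def, ← div_eq_mul_inv, eq_div_iff hbK]
    exact IsFractionRing.num_mul_den_eq_num_iff_eq.2 rfl
  have hcop := (IsFractionRing.num_den_reduced R x).isCoprime
  refine ⟨_, _, hb, hcop, hxab, ?_⟩
  obtain ⟨u, v, huv⟩ := hcop
  have : (algebraMap R K (IsFractionRing.den R x))⁻¹ = u • x + algebraMap R K v := by
    have h1 := congrArg (algebraMap R K) huv
    simp only [map_add, map_mul, map_one] at h1
    rw [Algebra.smul_def] at hxab ⊢
    nth_rw 2 [hxab]
    field_simp
    rw [← h1, mul_comm (algebraMap R K v)]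
  rw [this]
  exact S.add_mem (S.smul_mem hx u) (S.algebraMap_mem v)

/-- A subalgebra of the fraction field with finitely many subalgebras has the form `R[1/r]`. -/
theorem Subalgebra.exists_eq_adjoin_inv [IsPrincipalIdealRing R] {S : Subalgebra R K}
    (hS : {S' : Subalgebra R K | S' ≤ S}.Finite) :
    ∃ r : R, r ≠ 0 ∧ S = Algebra.adjoin R {(algebraMap R K r)⁻¹} := by
  let P : Set (Subalgebra R K) :=
    {S' | ∃ b : R, b ≠ 0 ∧ (algebraMap R K b)⁻¹ ∈ S ∧ S' = Algebra.adjoin R {(algebraMap R K b)⁻¹}}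
  have hP : P.Finite := hS.subset (by
    rintro _ ⟨b, -, hb, rfl⟩
    exact Algebra.adjoin_le (Set.singleton_subset_iff.2 hb))
  obtain ⟨_, ⟨b, hb0, hb, rfl⟩, hmax⟩ :=
    hP.exists_maximal ⟨_, 1, one_ne_zero, by simp, rfl⟩
  refine ⟨b, hb0, le_antisymm (fun x hx => ?_)
    (Algebra.adjoin_le (Set.singleton_subset_iff.2 hb))⟩
  obtain ⟨a, c, hc0, -, rfl, hc⟩ := Subalgebra.exists_isCoprime_smul_inv_eq hx
  have hbc : b * c ≠ 0 := mul_ne_zero hb0 hc0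
  have hself : (algebraMap R K (b * c))⁻¹ ∈ Algebra.adjoin R {(algebraMap R K (b * c))⁻¹} :=
    Algebra.self_mem_adjoin_singleton R _
  have hle : Algebra.adjoin R {(algebraMap R K (b * c))⁻¹} ≤
      Algebra.adjoin R {(algebraMap R K b)⁻¹} := by
    refine hmax ⟨b * c, hbc, ?_, rfl⟩ ?_
    · rw [map_mul, mul_inv]
      exact S.mul_mem hb hc
    · exact Algebra.adjoin_le (Set.singleton_subset_iff.2
        (Subalgebra.inv_algebraMap_mem_of_dvd (dvd_mul_right b c) hbc hself))
  exact Subalgebra.smul_mem _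
    (Subalgebra.inv_algebraMap_mem_of_dvd (dvd_mul_left c b) hbc (hle hself)) a

/-- The subalgebras of `R[1/r]` are generated by inverses of products of prime factors of `r`. -/
theorem Subalgebra.exists_subset_factors_eq_adjoin_inv [IsPrincipalIdealRing R] {r : R}
    (hr : r ≠ 0) {S : Subalgebra R K} (hS : S ≤ Algebra.adjoin R {(algebraMap R K r)⁻¹}) :
    ∃ F : Finset R, (∀ p ∈ F, p ∈ UniqueFactorizationMonoid.factors r) ∧
      S = Algebra.adjoin R {(algebraMap R K (∏ p ∈ F, p))⁻¹} := by
  have hfin : {p | p ∈ UniqueFactorizationMonoid.factors r ∧ (algebraMap R K p)⁻¹ ∈ S}.Finite :=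
    (Multiset.finite_toSet (UniqueFactorizationMonoid.factors r)).subset fun p hp => hp.1
  refine ⟨hfin.toFinset, fun p hp => (hfin.mem_toFinset.1 hp).1, ?_⟩
  set d := ∏ p ∈ hfin.toFinset, p with hd
  have hd0 : d ≠ 0 := Finset.prod_ne_zero_iff.2 fun p hp =>
    (UniqueFactorizationMonoid.prime_of_factor p (hfin.mem_toFinset.1 hp).1).ne_zero
  have hdS : (algebraMap R K d)⁻¹ ∈ S := by
    rw [hd, map_prod, ← Finset.prod_inv_distrib]
    exact S.prod_mem fun p hp => (hfin.mem_toFinset.1 hp).2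
  refine le_antisymm (fun x hx => ?_) (Algebra.adjoin_le (Set.singleton_subset_iff.2 hdS))
  obtain ⟨a, b, hb0, hcop, rfl, hb⟩ := Subalgebra.exists_isCoprime_smul_inv_eq hx
  refine Subalgebra.smul_mem _ ?_ a
  obtain ⟨n, c, hc⟩ := exists_pow_smul_eq_algebraMap_of_mem_adjoin_inv hr (hS hx)
  have hbr : b ∣ r ^ n := by
    refine hcop.symm.dvd_of_dvd_mul_right ⟨c, IsFractionRing.injective R K ?_⟩
    have hbK : algebraMap R K b ≠ 0 := by simpa using hb0
    rw [map_mul _ b, ← hc, smul_smul, Algebra.smul_def, mul_left_comm, mul_inv_cancel₀ hbK,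
      mul_one]
  clear hx hc hcop
  induction b using UniqueFactorizationMonoid.induction_on_prime with
  | h₁ => exact absurd rfl hb0
  | h₂ u hu =>
    refine Subalgebra.inv_algebraMap_mem_of_dvd hu.dvd one_ne_zero ?_
    rw [map_one, inv_one]
    exact Subalgebra.one_mem _
  | h₃ b p hb0' hp ih =>
    rw [map_mul, mul_inv]
    refine Subalgebra.mul_mem _ ?_ (ih hb0'
      (Subalgebra.inv_algebraMap_mem_of_dvd (dvd_mul_left b p) hb0 hb)
      ((dvd_mul_left b p).trans hbr))
    obtain ⟨q, hq, hpq⟩ := UniqueFactorizationMonoid.exists_mem_factors_of_dvd hr hp.irreducible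
      (hp.dvd_of_dvd_pow ((dvd_mul_right p b).trans hbr))
    have hqS : (algebraMap R K q)⁻¹ ∈ S :=
      Subalgebra.inv_algebraMap_mem_of_dvd (hpq.symm.dvd.trans (dvd_mul_right p b)) hb0 hb
    exact Subalgebra.inv_algebraMap_mem_of_dvd
      (hpq.dvd.trans (Finset.dvd_prod_of_mem _ (hfin.mem_toFinset.2 ⟨hq, hqS⟩))) hd0
      (Algebra.self_mem_adjoin_singleton R _)

variable {A : Type*} [Ring A] [Algebra R A]

/-- An extension of a subalgebra of `R[1/r]` by a finite ideal is futile. -/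
theorem IsFutile.of_algHom [IsPrincipalIdealRing R] (φ : A →ₐ[R] K)
    (hφ : {a : A | φ a = 0}.Finite) {r : R} (hr : r ≠ 0)
    (hrange : φ.range ≤ Algebra.adjoin R {(algebraMap R K r)⁻¹}) : IsFutile R A := by
  let Φ : Set R := {p | p ∈ UniqueFactorizationMonoid.factors r}
  have hΦ : Φ.Finite := Multiset.finite_toSet _
  let gen (F : Finset R) : K := (algebraMap R K (∏ p ∈ F, p))⁻¹
  let gens : Set K := gen '' (hΦ.toFinset.powerset : Set (Finset R))
  have hfiber (y : K) : (φ ⁻¹' {y}).Finite := by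
    rcases (φ ⁻¹' {y}).eq_empty_or_nonempty with h | ⟨a, rfl⟩
    · rw [h]
      exact Set.finite_empty
    · refine (hφ.image (a + ·)).subset fun b hb => ⟨b - a, ?_, add_sub_cancel a b⟩
      simpa [sub_eq_zero] using hb
  have hG : (φ ⁻¹' gens).Finite :=
    ((Finset.finite_toSet _).image gen).preimage' fun y _ => hfiber y
  have hfin := ((hG.prod hφ.powerset).image
    fun q => {x | ∃ y ∈ Algebra.adjoin R {q.1}, x - y ∈ q.2})
  have hrg : (Set.range ((↑) : Subalgebra R A → Set A)).Finite := by
    refine hfin.subset ?_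
    rintro _ ⟨B, rfl⟩
    obtain ⟨F, hF, hBF⟩ := Subalgebra.exists_subset_factors_eq_adjoin_inv hr
      (S := B.map φ) (le_trans (by rintro _ ⟨b, -, rfl⟩; exact ⟨b, rfl⟩) hrange)
    have hmem : gen F ∈ B.map φ := by
      rw [hBF]
      exact Algebra.self_mem_adjoin_singleton R _
    obtain ⟨b, hb, hbF⟩ := hmem
    have hbB : Algebra.adjoin R {b} ≤ B := Algebra.adjoin_le (Set.singleton_subset_iff.2 hb)
    refine ⟨(b, {a | a ∈ B ∧ φ a = 0}), ⟨⟨F, ?_, hbF.symm⟩, fun a ha => ha.2⟩, ?_⟩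
    · rw [Finset.mem_coe, Finset.mem_powerset]
      exact fun p hp => hΦ.mem_toFinset.2 (hF p hp)
    ext x
    constructor
    · rintro ⟨y, hy, hxy, -⟩
      simpa using B.add_mem hxy (hbB hy)
    · intro hx
      have hx' : φ x ∈ B.map φ := ⟨x, hx, rfl⟩
      have hadj : B.map φ = (Algebra.adjoin R {b}).map φ := by
        rw [AlgHom.map_adjoin, Set.image_singleton, hBF]
        exact congrArg (fun z => Algebra.adjoin R {z}) hbF.symm
      rw [hadj] at hx'
      obtain ⟨y, hy, hxy⟩ := hx'
      refine ⟨y, hy, B.sub_mem hx (hbB hy), ?_⟩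
      rw [map_sub, sub_eq_zero]
      exact hxy.symm
  have := hrg.to_subtype
  exact Finite.of_injective_finite_range SetLike.coe_injective

variable (K) in
/-- If every element of an algebra has a nonzero multiple in the base domain, then the algebra
modulo torsion embeds into the fraction field. -/
theorem exists_algHom_eq_zero_iff_of_exists_smul_eq_algebraMap
    (hinj : Function.Injective (algebraMap R A))
    (h : ∀ x : A, ∃ s : R, s ≠ 0 ∧ ∃ r : R, s • x = algebraMap R A r) :
    ∃ φ : A →ₐ[R] K, ∀ x, φ x = 0 ↔ ∃ s : R, s ≠ 0 ∧ s • x = 0 := by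
  choose s hs r hr using h
  let f (x : A) : K := algebraMap R K (r x) / algebraMap R K (s x)
  have hf {x : A} {a b : R} (hb : b ≠ 0) (hab : b • x = algebraMap R A a) :
      f x = algebraMap R K a / algebraMap R K b := by
    rw [div_eq_div_iff (by simpa using hs x) (by simpa using hb), ← map_mul, ← map_mul]
    congr 1
    apply hinj
    rw [map_mul, map_mul, ← hr, ← hab, smul_mul_assoc, ← Algebra.commutes, ← Algebra.smul_def,
      smul_mul_assoc, ← Algebra.commutes, ← Algebra.smul_def, smul_comm]
  have hsK (x : A) : algebraMap R K (s x) ≠ 0 := by simpa using hs x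
  have hfalg (a : R) : f (algebraMap R A a) = algebraMap R K a := by
    rw [hf one_ne_zero (one_smul R _), map_one, div_one]
  let φ : A →ₐ[R] K :=
    { toFun := f
      map_one' := by rw [← map_one (algebraMap R A), hfalg, map_one]
      map_zero' := by rw [← map_zero (algebraMap R A), hfalg, map_zero]
      map_mul' := fun x y => by
        rw [hf (a := r x * r y) (mul_ne_zero (hs x) (hs y))
          (by rw [map_mul, ← hr, ← hr, smul_mul_smul_comm]), map_mul, map_mul, mul_div_mul_comm]
      map_add' := fun x y => by
        rw [hf (a := s y * r x + s x * r y) (mul_ne_zero (hs x) (hs y))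
          (by rw [map_add, map_mul, map_mul, ← hr, ← hr, ← Algebra.smul_def, ← Algebra.smul_def,
            smul_add, smul_smul, smul_smul, mul_comm (s x)])]
        simp only [f]
        rw [div_add_div _ _ (hsK x) (hsK y)]
        simp only [map_add, map_mul]
        ring
      commutes' := hfalg }
  refine ⟨φ, fun x => ⟨fun hx => ⟨s x, hs x, ?_⟩, fun ⟨b, hb, hbx⟩ => ?_⟩⟩
  · have hrx : r x = 0 := by
      have hx' : f x = 0 := hx
      simpa [f, hs x] using hx'
    rw [hr, hrx, map_zero]
  · change f x = 0
    rw [hf (a := 0) hb (by rw [hbx, map_zero]), map_zero, zero_div]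

end FractionField

/-- The first isomorphism theorem for two-sided ideals of algebras. -/
theorem exists_twoSidedIdeal_quotient_algEquiv_range {R A B : Type*} [CommRing R] [Ring A]
    [Algebra R A] [Ring B] [Algebra R B] (φ : A →ₐ[R] B) :
    ∃ I : TwoSidedIdeal A, (∀ x, x ∈ I ↔ φ x = 0) ∧
      Nonempty (I.ringCon.Quotient ≃ₐ[R] φ.range) := by
  obtain ⟨I, e, hI, he⟩ : ∃ (I : TwoSidedIdeal A) (e : I.ringCon.Quotient ≃+* φ.range),
      (∀ x, I.ringCon x 0 ↔ φ x = φ 0) ∧ ∀ x, (e (I.ringCon.mk' x) : B) = φ x :=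
    ⟨.ofRingCon (RingCon.ker φ.toRingHom), RingCon.quotientKerEquivRange φ.toRingHom,
      fun _ => Iff.rfl, fun _ => rfl⟩
  refine ⟨I, fun x => ?_,
    ⟨{ e with commutes' := fun r => Subtype.ext ((he _).trans (φ.commutes r)) }⟩⟩
  rw [TwoSidedIdeal.mem_iff, hI, map_zero]

/-- Let `R` be a principal ideal domain which is not a field, all of whose residue fields at
nonzero primes are finite. Then an `R`-algebra `A` is `R`-futile if and only if either `A`
is finite, or the `R`-torsion ideal `A_tor` of `A` is finite and `A/A_tor` is isomorphic as
an `R`-algebra to the subalgebra `R[1/r]` of the fraction field `Q(R)` for some nonzero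
`r ∈ R`. -/
theorem isFutile_iff_of_pid_finite_residue
    {R A : Type*} [CommRing R] [IsDomain R] [IsPrincipalIdealRing R]
    (hnf : ¬ IsField R)
    (hres : ∀ p : Ideal R, p ≠ ⊥ → p.IsPrime → Finite (R ⧸ p))
    [Ring A] [Algebra R A] :
    IsFutile R A ↔
      (Finite A ∨
        ∃ I : TwoSidedIdeal A,
          (I : Set A) = {a : A | ∃ r : R, r ≠ 0 ∧ r • a = 0} ∧
          (I : Set A).Finite ∧
          ∃ r : R, r ≠ 0 ∧
            Nonempty (I.ringCon.Quotient ≃ₐ[R]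
              Algebra.adjoin R {(algebraMap R (FractionRing R) r)⁻¹})) := by
  constructor
  · intro hA
    have hfin := hA.finite_torsion hres
    by_cases hinj : Function.Injective (algebraMap R A)
    · right
      obtain ⟨φ, hφ⟩ := exists_algHom_eq_zero_iff_of_exists_smul_eq_algebraMap (FractionRing R)
        hinj (hA.exists_smul_eq_algebraMap hnf)
      have hsub : {S : Subalgebra R (FractionRing R) | S ≤ φ.range}.Finite := by
        have : Finite (Subalgebra R A) := hA
        refine (Set.finite_range (Subalgebra.map φ)).subset fun S hS => ⟨S.comap φ, ?_⟩
        exact SetLike.coe_injective (Set.image_preimage_eq_of_subset hS)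
      obtain ⟨r, hr, hrange⟩ := Subalgebra.exists_eq_adjoin_inv hsub
      obtain ⟨I, hI, ⟨e⟩⟩ := exists_twoSidedIdeal_quotient_algEquiv_range φ
      have hIT : (I : Set A) = {a : A | ∃ r : R, r ≠ 0 ∧ r • a = 0} :=
        Set.ext fun x => (hI x).trans (hφ x)
      exact ⟨I, hIT, hIT ▸ hfin, r, hr, ⟨e.trans (Subalgebra.equivOfEq _ _ hrange)⟩⟩
    · left
      rw [injective_iff_map_eq_zero] at hinj
      push Not at hinj
      obtain ⟨r, hr, hr0⟩ := hinj
      rw [← Set.finite_univ_iff]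
      exact hfin.subset fun a _ => ⟨r, hr0, by rw [Algebra.smul_def, hr, zero_mul]⟩
  · rintro (hA | ⟨I, -, hI, r, hr, ⟨e⟩⟩)
    · exact Finite.of_injective ((↑) : Subalgebra R A → Set A) SetLike.coe_injective
    · let π : A →ₐ[R] I.ringCon.Quotient := { RingCon.mk' I.ringCon with commutes' := fun _ => rfl }
      refine IsFutile.of_algHom ((Subalgebra.val _).comp (e.toAlgHom.comp π)) (hI.subset ?_) hr ?_
      · intro a ha
        have h0 : e (π a) = 0 := Subtype.ext ha
        rw [map_eq_zero_iff e e.injective] at h0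
        have : a ∈ TwoSidedIdeal.ker I.ringCon.mk' := (TwoSidedIdeal.mem_ker _).2 h0
        rwa [TwoSidedIdeal.ker_ringCon_mk'] at this
      · rintro _ ⟨a, rfl⟩
        exact (e (π a)).2
end

section
/- Let R ⊊ S be an extension of commutative rings with S integral over R, and let C = (R:S) = {x ∈ S : xS ⊆ R} be the conductor. Then S is an R-futile algebra if and only if R/C is an artinian ring and S/C is an (R/C)-futile algebra. -/
/-- The conductor `(R : S) = {x ∈ S : xS ⊆ R}` of a ring extension `R ⊆ S`, as an ideal
of `S`. -/
def conductorIdeal (R S : Type*) [CommRing R] [CommRing S] [Algebra R S] : Ideal S where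
  carrier := {x : S | ∀ s : S, x * s ∈ (algebraMap R S).range}
  zero_mem' := fun s => by simpa using Subring.zero_mem (algebraMap R S).range
  add_mem' := fun {x y} hx hy s => by
    simpa [add_mul] using add_mem (hx s) (hy s)
  smul_mem' := fun c x hx s => by
    rw [smul_eq_mul, mul_comm c x, mul_assoc]
    exact hx (c * s)

/-- A finite module annihilated by a maximal ideal is artinian. -/
theorem isArtinian_of_finite_of_isMaximal_smul_eq_zero {R M : Type*} [CommRing R] [AddCommGroup M]
    [Module R M] [Module.Finite R M] (m : Ideal R) [m.IsMaximal]
    (h : ∀ r ∈ m, ∀ x : M, r • x = 0) : IsArtinian R M := by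
  have ht : Module.IsTorsionBySet R M (m : Set R) := fun x r => h r r.2 x
  let _ := ht.module
  let _ := Ideal.Quotient.field m
  have : IsScalarTower R (R ⧸ m) M := ht.isScalarTower
  have : Module.Finite (R ⧸ m) M := Module.Finite.of_restrictScalars_finite R (R ⧸ m) M
  have : IsArtinian (R ⧸ m) M := inferInstance
  exact isArtinian_of_surjective_algebraMap (R := R ⧸ m) Ideal.Quotient.mk_surjective

namespace Subalgebra

variable {R S : Type*} [CommRing R] [CommRing S] [Algebra R S]

/-- For subalgebras `A ≤ B` and an ideal `I` of the base ring, the subalgebra `A + I B`. -/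
def addIdealSMul (A B : Subalgebra R S) (hAB : A ≤ B) (I : Ideal R) : Subalgebra R S :=
  (toSubmodule A ⊔ I • toSubmodule B).toSubalgebra
    (Submodule.mem_sup_left A.one_mem)
    (by
      have hmul : ∀ b ∈ B, ∀ y ∈ I • toSubmodule B, b * y ∈ I • toSubmodule B := by
        intro b hb y hy
        induction hy using Submodule.smul_induction_on' with
        | smul r hr n hn =>
          rw [mul_smul_comm]
          exact Submodule.smul_mem_smul hr (B.mul_mem hb hn)
        | add x _ y _ hx hy =>
          rw [mul_add]
          exact add_mem hx hy
      intro x y hx hy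
      obtain ⟨a, ha, b, hb, rfl⟩ := Submodule.mem_sup.mp hx
      obtain ⟨c, hc, d, hd, rfl⟩ := Submodule.mem_sup.mp hy
      have hdB : d ∈ B := Submodule.smul_le_right hd
      have hcB : c ∈ B := hAB hc
      have e : (a + b) * (c + d) = a * c + (a * d + (c * b + d * b)) := by ring
      rw [e]
      exact add_mem (Submodule.mem_sup_left (A.mul_mem ha hc)) (Submodule.mem_sup_right
        (add_mem (hmul _ (hAB ha) _ hd) (add_mem (hmul _ hcB _ hb) (hmul _ hdB _ hb)))))

theorem toSubmodule_addIdealSMul (A B : Subalgebra R S) (hAB : A ≤ B) (I : Ideal R) :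
    toSubmodule (addIdealSMul A B hAB I) = toSubmodule A ⊔ I • toSubmodule B :=
  rfl

/-- If `B` covers `A` and `B` is a finite module, then the elements of the base ring multiplying
`B` into `A` form a maximal ideal. -/
theorem exists_isMaximal_smul_mem_of_covBy {A B : Subalgebra R S} (h : A ⋖ B)
    (hB : (toSubmodule B).FG) :
    ∃ m : Ideal R, m.IsMaximal ∧ ∀ r ∈ m, ∀ b ∈ B, r • b ∈ A := by
  let m : Ideal R := (toSubmodule A).colon (toSubmodule B : Set S)
  have mem_m : ∀ r, r ∈ m ↔ ∀ b ∈ B, r • b ∈ A := fun r => Submodule.mem_colon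
  refine ⟨m, ?_, fun r hr => (mem_m r).mp hr⟩
  refine ⟨⟨fun htop => h.1.not_ge fun b hb => ?_, fun I hI => ?_⟩⟩
  · simpa using (mem_m 1).mp (htop ▸ Submodule.mem_top) b hb
  · have hle : A ≤ addIdealSMul A B h.1.le I := fun a ha => Submodule.mem_sup_left ha
    have hge : addIdealSMul A B h.1.le I ≤ B := by
      rw [← toSubmodule.le_iff_le, toSubmodule_addIdealSMul]
      exact sup_le h.1.le Submodule.smul_le_right
    rcases h.eq_or_eq hle hge with heq | heq
    · refine absurd (fun r hr => (mem_m r).mpr fun b hb => ?_) hI.not_ge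
      rw [← heq]
      exact Submodule.mem_sup_right (Submodule.smul_mem_smul hr hb)
    · let q := (toSubmodule A).mkQ
      have hN : (toSubmodule B).map q ≤ I • (toSubmodule B).map q := by
        conv_lhs => rw [← heq, toSubmodule_addIdealSMul]
        rw [Submodule.map_sup, Submodule.map_smul'', Submodule.mkQ_map_self, bot_sup_eq]
      obtain ⟨r, hrI, hr⟩ :=
        Submodule.exists_sub_one_mem_and_smul_eq_zero_of_fg_of_le_smul I _ (hB.map q) hN
      have hrm : r ∈ m := (mem_m r).mpr fun b hb => by
        have := hr (q b) (Submodule.mem_map_of_mem hb)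
        rwa [← map_smul, Submodule.mkQ_apply, Submodule.Quotient.mk_eq_zero] at this
      rw [Ideal.eq_top_iff_one]
      simpa using sub_mem (hI.le hrm) hrI

/-- In an integral algebra with finitely many subalgebras, all subalgebras are finite modules. -/
theorem fg_toSubmodule_of_finite [Algebra.IsIntegral R S] [Finite (Subalgebra R S)]
    (T : Subalgebra R S) : (toSubmodule T).FG := by
  induction T using WellFoundedLT.induction with
  | ind T ih =>
    rcases (bot_le (a := T)).eq_or_lt with rfl | hT
    · rw [Algebra.toSubmodule_bot, Submodule.one_eq_span]
      exact Submodule.fg_span_singleton 1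
    · obtain ⟨A, -, hA⟩ := exists_le_covBy_of_lt hT
      obtain ⟨x, hxT, hxA⟩ := SetLike.exists_of_lt hA.1
      have hle : A ⊔ Algebra.adjoin R {x} ≤ T :=
        sup_le hA.1.le (Algebra.adjoin_le (by simpa using hxT))
      have hsup : A ⊔ Algebra.adjoin R {x} = T :=
        (hA.eq_or_eq le_sup_left hle).resolve_left fun he => hxA <|
          he ▸ (le_sup_right : _ ≤ A ⊔ _) (Algebra.self_mem_adjoin_singleton R x)
      rw [← hsup, ← mul_toSubmodule]
      exact (ih A hA.1).mul (Algebra.IsIntegral.isIntegral x).fg_adjoin_singleton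

/-- In an integral algebra with finitely many subalgebras, the quotient module by any subalgebra
is artinian. -/
theorem isArtinian_quotient_of_finite [Algebra.IsIntegral R S] [Finite (Subalgebra R S)]
    (T : Subalgebra R S) : IsArtinian R (S ⧸ toSubmodule T) := by
  induction T using WellFoundedGT.induction with
  | ind T ih =>
    rcases (le_top (a := T)).eq_or_lt with rfl | hT
    · rw [Algebra.top_toSubmodule]
      infer_instance
    · obtain ⟨B, hB, -⟩ := exists_covBy_le_of_lt hT
      have hfg := fg_toSubmodule_of_finite B
      obtain ⟨m, hm, hmB⟩ := exists_isMaximal_smul_mem_of_covBy hB hfg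
      rw [isArtinian_iff_submodule_quotient ((toSubmodule B).map (toSubmodule T).mkQ)]
      constructor
      · have := Module.Finite.of_fg (hfg.map (toSubmodule T).mkQ)
        refine isArtinian_of_finite_of_isMaximal_smul_eq_zero m fun r hr x => Subtype.ext ?_
        obtain ⟨_, b, hb, rfl⟩ := x
        rw [Submodule.coe_smul, ← map_smul]
        exact (Submodule.Quotient.mk_eq_zero _).mpr (hmB r hr b hb)
      · have := ih B hB.1
        exact isArtinian_of_linearEquiv
          (Submodule.quotientQuotientEquivQuotient _ _ (toSubmodule.le_iff_le.mpr hB.1.le)).symm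

end Subalgebra

theorem mem_conductorIdeal {R S : Type*} [CommRing R] [CommRing S] [Algebra R S] {x : S} :
    x ∈ conductorIdeal R S ↔ ∀ s : S, x * s ∈ (algebraMap R S).range :=
  Iff.rfl

/-- If an integral algebra has finitely many subalgebras, then the base ring modulo the conductor
is artinian. -/
theorem IsFutile.isArtinianRing_quotient_conductorIdeal {R S : Type*} [CommRing R] [CommRing S]
    [Algebra R S] [Algebra.IsIntegral R S] (h : IsFutile R S) :
    IsArtinianRing (R ⧸ (conductorIdeal R S).comap (algebraMap R S)) := by
  have : Finite (Subalgebra R S) := h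
  have := Subalgebra.isArtinian_quotient_of_finite (⊥ : Subalgebra R S)
  obtain ⟨t, ht⟩ := Subalgebra.fg_toSubmodule_of_finite (⊤ : Subalgebra R S)
  let N := Subalgebra.toSubmodule (⊥ : Subalgebra R S)
  let f : R →ₗ[R] (t → S ⧸ N) :=
    LinearMap.pi fun s => N.mkQ ∘ₗ LinearMap.toSpanSingleton R S (s : S)
  have mem_N : ∀ x : S, x ∈ N ↔ x ∈ (algebraMap R S).range := fun x => Algebra.mem_bot
  have hker : LinearMap.ker f = (conductorIdeal R S).comap (algebraMap R S) := by
    ext r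
    have hf : r ∈ LinearMap.ker f ↔ ∀ s ∈ t, r • s ∈ N := by
      rw [LinearMap.mem_ker, funext_iff, Subtype.forall]
      exact forall₂_congr fun s _ => Submodule.Quotient.mk_eq_zero N
    rw [hf, Ideal.mem_comap, mem_conductorIdeal]
    constructor
    · intro hr s
      have hs : s ∈ Submodule.span R (t : Set S) := by rw [ht]; trivial
      have hle : Submodule.span R (t : Set S) ≤ N.comap (LinearMap.lsmul R S r) :=
        Submodule.span_le.mpr hr
      rw [← mem_N, ← Algebra.smul_def]
      exact hle hs
    · intro hr s _
      rw [mem_N, Algebra.smul_def]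
      exact hr s
  rw [← hker]
  have : IsArtinian R (R ⧸ LinearMap.ker f) :=
    isArtinian_of_linearEquiv f.quotKerEquivRange.symm
  exact isArtinian_of_tower R inferInstance

/-- Subalgebras of `S` over `R` correspond to subalgebras modulo the conductor. -/
theorem isFutile_iff_isFutile_quotient_conductorIdeal (R S : Type*) [CommRing R] [CommRing S]
    [Algebra R S] :
    IsFutile R S ↔ IsFutile (R ⧸ (conductorIdeal R S).comap (algebraMap R S))
      (S ⧸ conductorIdeal R S) := by
  let C := conductorIdeal R S
  let R' := R ⧸ C.comap (algebraMap R S)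
  let φ : Subalgebra R' (S ⧸ C) → Subalgebra R S := fun T =>
    (T.restrictScalars R).comap (Ideal.Quotient.mkₐ R C)
  have mem_φ : ∀ T s, s ∈ φ T ↔ Ideal.Quotient.mk C s ∈ T := fun _ _ => Iff.rfl
  have hφ : Function.Bijective φ := by
    constructor
    · intro T U hTU
      ext x
      obtain ⟨s, rfl⟩ := Ideal.Quotient.mk_surjective x
      rw [← mem_φ, ← mem_φ, hTU]
    · intro A
      let T : Subalgebra R' (S ⧸ C) :=
        { A.toSubring.map (Ideal.Quotient.mk C) with
          algebraMap_mem' := fun r => by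
            obtain ⟨r, rfl⟩ := Ideal.Quotient.mk_surjective r
            exact ⟨algebraMap R S r, A.algebraMap_mem r, rfl⟩ }
      refine ⟨T, ?_⟩
      ext s
      rw [mem_φ]
      constructor
      · rintro ⟨a, ha, has⟩
        obtain ⟨r, hr⟩ := mem_conductorIdeal.mp (Ideal.Quotient.eq.mp has) 1
        have hs : s = a - algebraMap R S r := by rw [hr]; ring
        rw [hs]
        exact sub_mem ha (A.algebraMap_mem r)
      · exact fun hs => ⟨s, hs, rfl⟩
  exact (Equiv.ofBijective φ hφ).finite_iff.symm

/-- Let `R ⊊ S` be an integral extension of commutative rings with conductor `C = (R : S)`.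
Then `S` is an `R`-futile algebra if and only if `R/C` is artinian and `S/C` is an
`(R/C)`-futile algebra. -/
theorem isFutile_iff_quotient_conductor_of_integral
    {R S : Type*} [CommRing R] [CommRing S] [Algebra R S]
    (hinj : Function.Injective (algebraMap R S))
    (hproper : ¬ Function.Surjective (algebraMap R S))
    [Algebra.IsIntegral R S] :
    IsFutile R S ↔
      (IsArtinianRing (R ⧸ (conductorIdeal R S).comap (algebraMap R S)) ∧
        IsFutile (R ⧸ (conductorIdeal R S).comap (algebraMap R S))
          (S ⧸ conductorIdeal R S)) := by
  rw [← isFutile_iff_isFutile_quotient_conductorIdeal]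
  exact ⟨fun h => ⟨h.isArtinianRing_quotient_conductorIdeal, h⟩, fun h => h.2⟩
end

section
/- Let R be an artinian commutative ring and let A be an R-futile R-algebra. Then A is finitely generated as an R-module (indeed of finite length). If moreover R is a finite set, then A is a finite set. -/
open Polynomial

namespace Polynomial

/-- Modulo a maximal ideal, a polynomial with a coefficient equal to `1` has a monic multiple by a
constant. -/
theorem exists_monic_map_eq_C_mul_map {R : Type*} [CommRing R] (P : Ideal R) [P.IsMaximal]
    {f : R[X]} {n : ℕ} (hn : f.coeff n = 1) :
    ∃ g : R[X], g.Monic ∧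
      ∃ c : R, g.map (Ideal.Quotient.mk P) = (C c * f).map (Ideal.Quotient.mk P) := by
  let := Ideal.Quotient.field P
  set q := Ideal.Quotient.mk P
  have hf : f.map q ≠ 0 := fun h => by
    simpa [hn] using congrArg (coeff · n) h
  have hlift : C (f.map q).leadingCoeff⁻¹ * f.map q ∈ lifts q :=
    (mem_lifts _).2 (map_surjective q Ideal.Quotient.mk_surjective _)
  have hmonic : (C (f.map q).leadingCoeff⁻¹ * f.map q).Monic := by
    rw [mul_comm]; exact monic_mul_leadingCoeff_inv hf
  obtain ⟨g, hg, -, hgm⟩ := lifts_and_natDegree_eq_and_monic hlift hmonic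
  obtain ⟨c, hc⟩ := Ideal.Quotient.mk_surjective (f.map q).leadingCoeff⁻¹
  exact ⟨g, hgm, c, by rw [hg, Polynomial.map_mul, map_C, ← hc]⟩

/-- Over an artinian ring, a polynomial with a coefficient equal to `1` divides a monic one. -/
theorem exists_monic_dvd_of_coeff_eq_one {R : Type*} [CommRing R] [IsArtinianRing R]
    {f : R[X]} {n : ℕ} (hn : f.coeff n = 1) : ∃ g : R[X], g.Monic ∧ f ∣ g := by
  have : Fintype (MaximalSpectrum R) := Fintype.ofFinite _
  choose g hg c hc using fun P : MaximalSpectrum R =>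
    haveI := P.isMaximal
    exists_monic_map_eq_C_mul_map P.asIdeal hn
  have hmem : ∏ P, g P ∈ (Ideal.span {f}).radical := by
    rw [Ideal.radical_eq_sInf, Ideal.mem_sInf]
    rintro Q ⟨hfQ, hQ⟩
    have hP : (Q.comap (C : R →+* R[X])).IsPrime := Ideal.comap_isPrime _ _
    let P : MaximalSpectrum R := ⟨Q.comap C, inferInstance⟩
    refine Ideal.mem_of_dvd Q (Finset.dvd_prod_of_mem g (Finset.mem_univ P)) ?_
    have hfmem : C (c P) * f ∈ Q :=
      Q.mul_mem_left _ (hfQ (Ideal.mem_span_singleton_self f))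
    have hsub : g P - C (c P) * f ∈ Q := by
      have h : g P - C (c P) * f ∈ P.asIdeal.map (C : R →+* R[X]) := by
        rw [Ideal.mem_map_C_iff]
        intro k
        have := congrArg (coeff · k) (hc P)
        simp only [coeff_map] at this
        rw [coeff_sub]
        exact Ideal.Quotient.eq.1 this
      exact Ideal.map_comap_le h
    simpa using Q.add_mem hsub hfmem
  obtain ⟨k, hk⟩ := hmem
  exact ⟨(∏ P, g P) ^ k, (monic_prod_of_monic _ _ fun P _ => hg P).pow k,
    Ideal.mem_span_singleton.1 hk⟩

end Polynomial

namespace IsFutile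

variable {R A : Type*} [CommRing R] [Ring A] [Algebra R A]

/-- Every element of a futile algebra is a root of a polynomial with a coefficient equal to `1`. -/
theorem exists_aeval_eq_zero (hfut : IsFutile R A) (a : A) :
    ∃ (f : R[X]) (n : ℕ), f.coeff n = 1 ∧ aeval a f = 0 := by
  have : Finite (Subalgebra R A) := hfut
  obtain ⟨i, -, j, -, hij, h⟩ := Set.infinite_univ.exists_lt_map_eq_of_mapsTo
    (f := fun i : ℕ => Algebra.adjoin R {a ^ (i + 1)}) (t := Set.univ)
    (fun _ _ => Set.mem_univ _) Set.finite_univ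
  have hmem : a ^ (i + 1) ∈ Algebra.adjoin R {a ^ (j + 1)} := by
    rw [← show Algebra.adjoin R {a ^ (i + 1)} = Algebra.adjoin R {a ^ (j + 1)} from h]
    exact Algebra.self_mem_adjoin_singleton R _
  rw [Algebra.adjoin_singleton_eq_range_aeval] at hmem
  obtain ⟨p, hp⟩ := hmem
  refine ⟨X ^ (i + 1) - expand R (j + 1) p, i + 1, ?_, ?_⟩
  · have hdvd : ¬ j + 1 ∣ i + 1 := fun h => by
      have := Nat.le_of_dvd i.succ_pos h
      omega
    rw [coeff_sub, coeff_X_pow_self, coeff_expand j.succ_pos, if_neg hdvd, sub_zero]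
  · rw [map_sub, map_pow, aeval_X, expand_aeval]
    exact sub_eq_zero.2 hp.symm

theorem isIntegral [IsArtinianRing R] (hfut : IsFutile R A) (a : A) : IsIntegral R a := by
  obtain ⟨f, n, hn, hf⟩ := hfut.exists_aeval_eq_zero a
  obtain ⟨g, hg, q, rfl⟩ := exists_monic_dvd_of_coeff_eq_one hn
  refine ⟨f * q, hg, ?_⟩
  rw [← aeval_def, map_mul, hf, zero_mul]

/-- A futile algebra over an artinian ring is a finite sum of its one-generated subalgebras,
each of which is a finite module. -/
theorem module_finite [IsArtinianRing R] (hfut : IsFutile R A) : Module.Finite R A := by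
  have : Finite (Subalgebra R A) := hfut
  let S : Set (Subalgebra R A) := Set.range fun a : A => Algebra.adjoin R {a}
  have hS : (⨆ B : S, Subalgebra.toSubmodule B.1) = ⊤ := by
    refine eq_top_iff.2 fun a _ => ?_
    exact Submodule.mem_iSup_of_mem (⟨_, a, rfl⟩ : S) (Algebra.self_mem_adjoin_singleton R a)
  refine ⟨hS ▸ Submodule.fg_iSup _ ?_⟩
  rintro ⟨_, a, rfl⟩
  exact (hfut.isIntegral a).fg_adjoin_singleton

end IsFutile

/-- Let `R` be an artinian commutative ring and `A` a futile `R`-algebra. Then `A` is a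
finitely generated `R`-module (indeed of finite length), and if `R` is a finite set then so
is `A`. -/
theorem finite_module_of_futile_of_artinian
    {R A : Type*} [CommRing R] [IsArtinianRing R] [Ring A] [Algebra R A]
    (hfut : IsFutile R A) :
    (Module.Finite R A ∧ IsFiniteLength R A) ∧ (Finite R → Finite A) := by
  have := hfut.module_finite
  exact ⟨⟨this, isFiniteLength_iff_isNoetherian_isArtinian.2 ⟨inferInstance, inferInstance⟩⟩,
    fun _ => Module.finite_of_finite R⟩
end

section
/- Let R be a commutative ring and A an R-futile R-algebra. Then there exist n ∈ ℤ_{≥0} and elements α_1, …, α_n ∈ A such that A = ⋃_{i=1}^n R[α_i] and for each i the quotient R-module A/R[α_i] is finite. -/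
open scoped Pointwise in
/-- In a finite cover of a module by submodules, the members with finite quotient
already cover. -/
theorem Submodule.exists_mem_finite_quotient_of_cover {R M ι : Type*} [Ring R] [AddCommGroup M]
    [Module R M] [Finite ι] (p : ι → Submodule R M) (hp : ∀ x, ∃ i, x ∈ p i) (x : M) :
    ∃ i, x ∈ p i ∧ Finite (M ⧸ p i) := by
  classical
  have := Fintype.ofFinite ι
  have hcovers : ⋃ i ∈ (Finset.univ : Finset ι), (0 : M) +ᵥ ((p i).toAddSubgroup : Set M) =
      Set.univ := by
    simpa [Set.eq_univ_iff_forall] using hp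
  have hx : x ∈ (Set.univ : Set M) := Set.mem_univ x
  rw [← AddSubgroup.leftCoset_cover_filter_FiniteIndex hcovers] at hx
  simp only [Finset.mem_filter, Finset.mem_univ, true_and, zero_vadd, Set.mem_iUnion] at hx
  obtain ⟨i, hi, hxi⟩ := hx
  exact ⟨i, hxi, AddSubgroup.finite_quotient_of_finiteIndex (H := (p i).toAddSubgroup)⟩

/-- If `A` is a futile `R`-algebra, then there are finitely many elements `α₁, …, αₙ ∈ A`
such that `A = ⋃ᵢ R[αᵢ]` and each quotient `R`-module `A / R[αᵢ]` is finite. -/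
theorem futile_union_of_monogenic_of_finite_index
    {R A : Type*} [CommRing R] [Ring A] [Algebra R A]
    (hfut : IsFutile R A) :
    ∃ (n : ℕ) (α : Fin n → A),
      (∀ a : A, ∃ i, a ∈ Algebra.adjoin R {α i}) ∧
      (∀ i, Finite (A ⧸ Subalgebra.toSubmodule (Algebra.adjoin R {α i}))) := by
  have : Finite (Subalgebra R A) := hfut
  let T := {S : Subalgebra R A // ∃ a, Algebra.adjoin R {a} = S}
  let F := {S : T // Finite (A ⧸ Subalgebra.toSubmodule S.1)}
  obtain ⟨n, ⟨e⟩⟩ := Finite.exists_equiv_fin F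
  choose gen hgen using fun S : T ↦ S.2
  refine ⟨n, fun i ↦ gen (e.symm i).1, fun a ↦ ?_, fun i ↦ ?_⟩
  · obtain ⟨S, ha, hS⟩ := Submodule.exists_mem_finite_quotient_of_cover
      (fun S : T ↦ Subalgebra.toSubmodule S.1)
      (fun x ↦ ⟨⟨_, x, rfl⟩, Algebra.self_mem_adjoin_singleton R x⟩) a
    refine ⟨e ⟨S, hS⟩, ?_⟩
    simp only [e.symm_apply_apply, hgen]
    exact ha
  · rw [hgen]
    exact (e.symm i).2
end

section
/- Let A be a (not necessarily commutative) ring such that the quotient of the additive group of A by its center Z(A) is finite. Then the commutator ideal [A,A], i.e. the two-sided ideal of A generated by all elements ab - ba with a, b ∈ A, is a finite set. -/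
section CommutatorIdeal

variable {A : Type*} [Ring A]

/-- An element differs from the chosen representative of its class by a central element. -/
lemma exists_center_add_out_eq (a : A) :
    ∃ z ∈ Subring.center A,
      a = z + (QuotientAddGroup.mk a : A ⧸ (Subring.center A).toAddSubgroup).out := by
  obtain ⟨z, hz⟩ := QuotientAddGroup.mk_out_eq_add (Subring.center A).toAddSubgroup a
  refine ⟨-z, neg_mem z.2, ?_⟩
  rw [hz]
  abel

lemma finite_setOf_commutators [Finite (A ⧸ (Subring.center A).toAddSubgroup)] :
    {x : A | ∃ a b : A, x = a * b - b * a}.Finite := by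
  refine (Set.finite_range fun p : (A ⧸ (Subring.center A).toAddSubgroup) ×
    (A ⧸ (Subring.center A).toAddSubgroup) =>
      p.1.out * p.2.out - p.2.out * p.1.out).subset ?_
  rintro _ ⟨a, b, rfl⟩
  refine ⟨(QuotientAddGroup.mk a, QuotientAddGroup.mk b), ?_⟩
  obtain ⟨z, hz, ha⟩ := exists_center_add_out_eq a
  obtain ⟨w, hw, hb⟩ := exists_center_add_out_eq b
  rw [Subring.mem_center_iff] at hz hw
  generalize (QuotientAddGroup.mk a : A ⧸ (Subring.center A).toAddSubgroup) = q at *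
  generalize (QuotientAddGroup.mk b : A ⧸ (Subring.center A).toAddSubgroup) = r at *
  subst ha hb
  simp only [add_mul, mul_add, hw z, hw q.out, hz r.out]
  abel

lemma finite_setOf_mul_commutators [Finite (A ⧸ (Subring.center A).toAddSubgroup)] :
    {x : A | ∃ r a b : A, x = r * (a * b - b * a)}.Finite := by
  refine (Set.Finite.image2 (· + ·) (finite_setOf_commutators (A := A))
    (Set.Finite.image2 (· * ·)
      (Set.finite_range (Quotient.out : A ⧸ (Subring.center A).toAddSubgroup → A))
      finite_setOf_commutators)).subset ?_
  rintro _ ⟨r, a, b, rfl⟩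
  obtain ⟨z, hz, hr⟩ := exists_center_add_out_eq r
  rw [Subring.mem_center_iff] at hz
  refine ⟨z * a * b - b * (z * a), ⟨z * a, b, rfl⟩, _,
    ⟨_, ⟨QuotientAddGroup.mk r, rfl⟩, _, ⟨a, b, rfl⟩, rfl⟩, ?_⟩
  conv_rhs => rw [hr]
  simp only [add_mul, mul_sub, ← mul_assoc, hz b]
  abel

lemma card_nsmul_commutator (a b : A) :
    Nat.card (A ⧸ (Subring.center A).toAddSubgroup) • (a * b - b * a) = 0 := by
  have h : Nat.card (A ⧸ (Subring.center A).toAddSubgroup) • a ∈ Subring.center A :=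
    (QuotientAddGroup.eq_zero_iff (N := (Subring.center A).toAddSubgroup) _).1 <| by
      rw [QuotientAddGroup.mk_nsmul, card_nsmul_eq_zero']
  rw [nsmul_sub, ← smul_mul_assoc, ← mul_smul_comm, Subring.mem_center_iff.1 h b, sub_self]

/-- The additive subgroup generated by the left multiples of commutators is finite. -/
lemma finite_closure_mul_commutators [Finite (A ⧸ (Subring.center A).toAddSubgroup)] :
    Finite (AddSubgroup.closure {x : A | ∃ r a b : A, x = r * (a * b - b * a)}) := by
  have : Finite {x : A | ∃ r a b : A, x = r * (a * b - b * a)} := finite_setOf_mul_commutators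
  refine AddCommGroup.finite_of_fg_isAddTorsion _ fun ⟨x, hx⟩ => ?_
  rw [isOfFinAddOrder_iff_nsmul_eq_zero]
  refine ⟨_, Nat.card_pos (α := A ⧸ (Subring.center A).toAddSubgroup), Subtype.ext ?_⟩
  rw [AddSubgroup.coe_nsmul, AddSubgroup.coe_zero]
  induction hx using AddSubgroup.closure_induction with
  | mem x hx =>
    obtain ⟨r, a, b, rfl⟩ := hx
    rw [← mul_smul_comm, card_nsmul_commutator, mul_zero]
  | zero => exact smul_zero _
  | add x y _ _ hx hy => rw [nsmul_add, hx, hy, add_zero]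
  | neg x _ hx => rw [smul_neg, hx, neg_zero]

lemma commutatorIdeal_subset_closure :
    (commutatorIdeal A : Set A) ⊆
      AddSubgroup.closure {x : A | ∃ r a b : A, x = r * (a * b - b * a)} := by
  let G := AddSubgroup.closure {x : A | ∃ r a b : A, x = r * (a * b - b * a)}
  have mul_left {x y : A} (hy : y ∈ G) : x * y ∈ G := by
    induction hy using AddSubgroup.closure_induction with
    | mem y hy =>
      obtain ⟨r, a, b, rfl⟩ := hy
      exact AddSubgroup.subset_closure ⟨x * r, a, b, (mul_assoc _ _ _).symm⟩
    | zero => rw [mul_zero]; exact zero_mem _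
    | add y z _ _ hy hz => rw [mul_add]; exact add_mem hy hz
    | neg y _ hy => rw [mul_neg]; exact neg_mem hy
  have mul_right {x y : A} (hx : x ∈ G) : x * y ∈ G := by
    induction hx using AddSubgroup.closure_induction with
    | mem x hx =>
      obtain ⟨r, a, b, rfl⟩ := hx
      have h : r * (a * b - b * a) * y =
          r * (a * (b * y) - b * y * a) - r * b * (a * y - y * a) := by
        noncomm_ring
      rw [h]
      exact sub_mem (AddSubgroup.subset_closure ⟨_, _, _, rfl⟩)
        (AddSubgroup.subset_closure ⟨_, _, _, rfl⟩)
    | zero => rw [zero_mul]; exact zero_mem _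
    | add y z _ _ hy hz => rw [add_mul]; exact add_mem hy hz
    | neg y _ hy => rw [neg_mul]; exact neg_mem hy
  let I : TwoSidedIdeal A :=
    .mk' G (zero_mem G) (fun hx hy => add_mem hx hy) (fun hx => neg_mem hx) mul_left mul_right
  have hI : (I : Set A) = G := TwoSidedIdeal.coe_mk' ..
  have hle : commutatorIdeal A ≤ I := by
    refine TwoSidedIdeal.span_le.2 ?_
    rintro _ ⟨a, b, rfl⟩
    rw [hI]
    exact AddSubgroup.subset_closure ⟨1, a, b, (one_mul _).symm⟩
  exact fun x hx => hI.subset (hle hx)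

end CommutatorIdeal

/-- If the quotient of the additive group of a ring `A` by its center is finite, then the
commutator ideal `[A,A]` is a finite set. -/
theorem commutatorIdeal_finite_of_finite_quotient_center
    (A : Type*) [Ring A]
    (h : Finite (A ⧸ (Subring.center A).toAddSubgroup)) :
    (commutatorIdeal A : Set A).Finite :=
  (Set.finite_coe_iff.1 finite_closure_mul_commutators).subset commutatorIdeal_subset_closure
end

section
/- Let R be a commutative ring and suppose A is an R-futile R-algebra. Then the center Z(A) has finite index in A (i.e. the additive quotient group A/Z(A) is finite), and the commutator ideal [A,A] is a finite set. -/
open scoped Pointwise Algebra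

/-- By B. H. Neumann's covering lemma, the commutative subalgebras `R[a]` of finite index cover a
futile algebra `A`, so their intersection is a central subgroup of finite index. -/
theorem IsFutile.finiteIndex_center {R A : Type*} [CommRing R] [Ring A] [Algebra R A]
    (hfut : IsFutile R A) : (Subring.center A).toAddSubgroup.FiniteIndex := by
  classical
  have : Finite (Subalgebra R A) := hfut
  let s : Finset (Subalgebra R A) := (Set.toFinite (Set.range fun a : A ↦ R[a])).toFinset
  let H : Subalgebra R A → AddSubgroup A := fun S ↦ S.toSubring.toAddSubgroup
  have hcovers : ⋃ S ∈ s, (0 : A) +ᵥ (H S : Set A) = Set.univ := by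
    refine Set.eq_univ_of_forall fun a ↦ Set.mem_iUnion₂.2 ⟨R[a], by simp [s], ?_⟩
    simp [H]
  have hfilter := AddSubgroup.leftCoset_cover_filter_FiniteIndex hcovers
  let D : AddSubgroup A := ⨅ S ∈ s.filter fun S ↦ (H S).FiniteIndex, H S
  have hD : D.FiniteIndex := AddSubgroup.finiteIndex_iInf' _ <| by simp
  refine AddSubgroup.finiteIndex_of_le (H := D) fun d hd ↦ Subring.mem_center_iff.2 fun b ↦ ?_
  have hb : b ∈ ⋃ S ∈ s.filter (fun S ↦ (H S).FiniteIndex), (0 : A) +ᵥ (H S : Set A) :=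
    hfilter ▸ Set.mem_univ b
  obtain ⟨S, hS, hbS⟩ := Set.mem_iUnion₂.1 hb
  have hdS : d ∈ H S := (iInf₂_le S hS : D ≤ H S) hd
  rw [zero_vadd] at hbS
  obtain ⟨a, rfl⟩ : ∃ a : A, R[a] = S := by simpa [s] using (Finset.mem_filter.1 hS).1
  exact setLike_mul_comm (s := R[a]) hbS hdS

section FiniteIndexCenter

variable {A : Type*} [Ring A]

theorem exists_finite_forall_sub_mem_center [(Subring.center A).toAddSubgroup.FiniteIndex] :
    ∃ F : Set A, F.Finite ∧ ∀ a, ∃ f ∈ F, a - f ∈ Subring.center A := by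
  refine ⟨Set.range fun q : A ⧸ (Subring.center A).toAddSubgroup ↦ q.out,
    Set.finite_range _, fun a ↦ ⟨_, ⟨(a : A ⧸ (Subring.center A).toAddSubgroup), rfl⟩, ?_⟩⟩
  have h := QuotientAddGroup.eq.1
    (QuotientAddGroup.out_eq' (a : A ⧸ (Subring.center A).toAddSubgroup))
  rwa [neg_add_eq_sub] at h

/-- A commutator depends only on the classes of its entries modulo the center. -/
theorem finite_setOf_commutator [(Subring.center A).toAddSubgroup.FiniteIndex] :
    {x : A | ∃ a b : A, x = a * b - b * a}.Finite := by
  obtain ⟨F, hF, hrep⟩ := exists_finite_forall_sub_mem_center (A := A)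
  refine (hF.image2 (fun f g ↦ f * g - g * f) hF).subset ?_
  rintro _ ⟨a, b, rfl⟩
  obtain ⟨f, hf, ha⟩ := hrep a
  obtain ⟨g, hg, hb⟩ := hrep b
  refine ⟨f, hf, g, hg, ?_⟩
  have h₁ := Subring.mem_center_iff.1 ha b
  have h₂ := Subring.mem_center_iff.1 hb f
  linear_combination (norm := noncomm_ring) h₁ - h₂

theorem center_mul_setOf_commutator_subset :
    (Subring.center A : Set A) * {x : A | ∃ a b : A, x = a * b - b * a} ⊆
      {x : A | ∃ a b : A, x = a * b - b * a} := by
  rintro _ ⟨z, hz, _, ⟨a, b, rfl⟩, rfl⟩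
  refine ⟨z * a, b, ?_⟩
  have h := Subring.mem_center_iff.1 hz b
  simp only [mul_sub, ← mul_assoc, h]

theorem Set.Finite.univ_mul_of_center_mul_subset
    [(Subring.center A).toAddSubgroup.FiniteIndex] {C : Set A} (hC : C.Finite)
    (hZ : (Subring.center A : Set A) * C ⊆ C) : (Set.univ * C).Finite := by
  obtain ⟨F, hF, hrep⟩ := exists_finite_forall_sub_mem_center (A := A)
  refine (hC.add (hF.mul hC)).subset ?_
  rintro _ ⟨x, -, c, hc, rfl⟩
  obtain ⟨f, hf, hx⟩ := hrep x
  exact ⟨(x - f) * c, hZ (Set.mul_mem_mul hx hc), f * c, Set.mul_mem_mul hf hc, by simp [sub_mul]⟩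

theorem Set.Finite.mul_univ_of_mul_center_subset
    [(Subring.center A).toAddSubgroup.FiniteIndex] {C : Set A} (hC : C.Finite)
    (hZ : C * (Subring.center A : Set A) ⊆ C) : (C * Set.univ).Finite := by
  obtain ⟨F, hF, hrep⟩ := exists_finite_forall_sub_mem_center (A := A)
  refine (hC.add (hC.mul hF)).subset ?_
  rintro _ ⟨c, hc, x, -, rfl⟩
  obtain ⟨f, hf, hx⟩ := hrep x
  exact ⟨c * (x - f), hZ (Set.mul_mem_mul hc hx), c * f, Set.mul_mem_mul hc hf, by simp [mul_sub]⟩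

theorem AddSubgroup.finite_closure_of_nsmul_eq_zero {M : Type*} [AddCommGroup M] {T : Set M}
    (hT : T.Finite) {n : ℕ} (hn : n ≠ 0) (h : ∀ t ∈ T, n • t = 0) :
    (AddSubgroup.closure T : Set M).Finite := by
  have : Finite T := hT
  have hker : AddSubgroup.closure T ≤ (nsmulAddMonoidHom n : M →+ M).ker :=
    (AddSubgroup.closure_le _).2 fun t ht ↦ h t ht
  have : Finite (AddSubgroup.closure T) :=
    AddCommGroup.finite_of_fg_isAddTorsion _ fun x ↦
      isOfFinAddOrder_iff_nsmul_eq_zero.2 ⟨n, Nat.pos_of_ne_zero hn, Subtype.ext (hker x.2)⟩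
  exact Set.toFinite _

theorem index_center_nsmul_commutator (a b : A) :
    (Subring.center A).toAddSubgroup.index • (a * b - b * a) = 0 := by
  have h : (Subring.center A).toAddSubgroup.index • a ∈ Subring.center A :=
    (Subring.center A).toAddSubgroup.nsmul_index_mem a
  rw [smul_sub, ← smul_mul_assoc, ← mul_smul_comm, Subring.mem_center_iff.1 h b, sub_self]

theorem finite_commutatorIdeal [hfi : (Subring.center A).toAddSubgroup.FiniteIndex] :
    (commutatorIdeal A : Set A).Finite := by
  have hleft := finite_setOf_commutator.univ_mul_of_center_mul_subset
    (center_mul_setOf_commutator_subset (A := A))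
  have hboth := hleft.mul_univ_of_mul_center_subset <| by
    rintro _ ⟨_, ⟨x, -, c, hc, rfl⟩, z, hz, rfl⟩
    refine ⟨z * x, Set.mem_univ _, c, hc, ?_⟩
    exact (mul_assoc z x c).trans (Subring.mem_center_iff.1 hz (x * c)).symm
  refine (AddSubgroup.finite_closure_of_nsmul_eq_zero hboth hfi.index_ne_zero ?_).subset
    fun x hx ↦ TwoSidedIdeal.mem_span_iff_mem_addSubgroup_closure.1 hx
  rintro _ ⟨_, ⟨x, -, _, ⟨a, b, rfl⟩, rfl⟩, y, -, rfl⟩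
  rw [← smul_mul_assoc, ← mul_smul_comm, index_center_nsmul_commutator, mul_zero, zero_mul]

end FiniteIndexCenter

/-- If `A` is a futile `R`-algebra, then the center `Z(A)` has finite additive index in `A`
and the commutator ideal `[A,A]` is a finite set. -/
theorem finite_index_center_and_commutatorIdeal_finite_of_futile
    {R A : Type*} [CommRing R] [Ring A] [Algebra R A]
    (hfut : IsFutile R A) :
    Finite (A ⧸ (Subring.center A).toAddSubgroup) ∧ (commutatorIdeal A : Set A).Finite := by
  have := hfut.finiteIndex_center
  exact ⟨inferInstance, finite_commutatorIdeal⟩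
end

section
/- Let R be a commutative domain that is not a field, with fraction field K = Q(R). Let A be a nonzero R-algebra which is R-futile and torsion-free as an R-module. Then the structure map R → A is injective and A embeds as an R-algebra into K; that is, up to R-algebra isomorphism one has R ⊆ A ⊆ Q(R). -/
open Polynomial

/-- The polynomial expressing the relation `p ^ n • a = g (p ^ m • a)` has a nonzero linear
coefficient, provided `n < m` and `p` is a nonzero nonunit. -/
theorem coeff_one_C_mul_X_sub_comp_ne_zero {R : Type*} [CommRing R] [IsDomain R] {p : R}
    (hp0 : p ≠ 0) (hpu : ¬ IsUnit p) {n m : ℕ} (hnm : n < m) (g : R[X]) :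
    (C (p ^ n) * X - g.comp (C (p ^ m) * X)).coeff 1 ≠ 0 := by
  obtain ⟨k, rfl⟩ := Nat.exists_eq_add_of_lt hnm
  rw [coeff_sub, coeff_C_mul, coeff_X_one, comp_C_mul_X_coeff, mul_one, pow_one]
  intro h
  have h' : p ^ n * (1 - p * (p ^ k * g.coeff 1)) = 0 := by linear_combination h
  rcases mul_eq_zero.mp h' with h0 | h0
  · exact pow_ne_zero n hp0 h0
  · exact hpu (IsUnit.of_mul_eq_one _ (sub_eq_zero.mp h0).symm)

theorem aeval_C_mul_X_sub_comp_eq_zero {R A : Type*} [CommRing R] [Ring A] [Algebra R A]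
    {r s : R} {a : A} {g : R[X]} (h : r • a = aeval (s • a) g) :
    aeval a (C r * X - g.comp (C s * X)) = 0 := by
  simp [aeval_comp, h, ← Algebra.smul_def]

theorem IsFutile.exists_pow_smul_eq_aeval {R A : Type*} [CommRing R] [Ring A] [Algebra R A]
    (hfut : IsFutile R A) (p : R) (a : A) :
    ∃ n m : ℕ, n < m ∧ ∃ g : R[X], p ^ n • a = aeval (p ^ m • a) g := by
  have : Finite (Subalgebra R A) := hfut
  obtain ⟨n, m, hne, h⟩ := Finite.exists_ne_map_eq_of_infinite
    fun n : ℕ => Algebra.adjoin R {p ^ n • a}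
  wlog hnm : n < m generalizing n m
  · exact this m n hne.symm h.symm (by lia)
  have hmem : p ^ n • a ∈ Algebra.adjoin R {p ^ m • a} :=
    h ▸ Algebra.self_mem_adjoin_singleton R _
  rw [Algebra.adjoin_singleton_eq_range_aeval] at hmem
  obtain ⟨g, hg⟩ := hmem
  exact ⟨n, m, hnm, g, hg.symm⟩

/-- In a futile algebra over a domain which is not a field, an element satisfying a monic
polynomial of degree at least two satisfies a nonzero polynomial of smaller degree. -/
theorem IsFutile.exists_natDegree_lt {R A : Type*} [CommRing R] [IsDomain R] (hnf : ¬ IsField R)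
    [Ring A] [Algebra R A] (hfut : IsFutile R A) {b : A} {f : R[X]} (hf : f.Monic)
    (hfb : aeval b f = 0) (hdeg : 2 ≤ f.natDegree) :
    ∃ q : R[X], q ≠ 0 ∧ aeval b q = 0 ∧ q.natDegree < f.natDegree := by
  obtain ⟨p, hp0, hpu⟩ := Ring.exists_not_isUnit_of_not_isField hnf
  obtain ⟨n, m, hnm, g, hg⟩ := hfut.exists_pow_smul_eq_aeval p b
  have hmonic : (scaleRoots f (p ^ m)).Monic := (monic_scaleRoots_iff _).mpr hf
  have hroot : aeval (p ^ m • b) (scaleRoots f (p ^ m)) = 0 := by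
    rw [Algebra.smul_def]
    exact scaleRoots_aeval_eq_zero hfb
  rw [← aeval_modByMonic_eq_self_of_root hroot] at hg
  set g' := g %ₘ scaleRoots f (p ^ m)
  have hg' : g'.natDegree < f.natDegree := by
    have h := natDegree_modByMonic_lt g hmonic fun h => by
      have := congr_arg natDegree h
      rw [natDegree_scaleRoots, natDegree_one] at this
      lia
    rwa [natDegree_scaleRoots] at h
  refine ⟨C (p ^ n) * X - g'.comp (C (p ^ m) * X), fun h => ?_,
    aeval_C_mul_X_sub_comp_eq_zero hg, ?_⟩
  · exact coeff_one_C_mul_X_sub_comp_ne_zero hp0 hpu hnm g' (by rw [h, coeff_zero])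
  · have h1 : (C (p ^ n) * X : R[X]).natDegree ≤ 1 := (natDegree_C_mul_le _ _).trans natDegree_X_le
    have h2 : (g'.comp (C (p ^ m) * X)).natDegree = g'.natDegree := by
      rw [natDegree_comp, natDegree_C_mul_X _ (pow_ne_zero m hp0), mul_one]
    have h3 := natDegree_sub_le (C (p ^ n) * X) (g'.comp (C (p ^ m) * X))
    rw [h2] at h3
    lia

theorem IsFutile.exists_smul_eq_algebraMap_s17 {R A : Type*} [CommRing R] [IsDomain R]
    (hnf : ¬ IsField R) [Ring A] [Algebra R A] (hfut : IsFutile R A)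
    (hinj : Function.Injective (algebraMap R A)) (a : A) :
    ∃ r s : R, r ≠ 0 ∧ r • a = algebraMap R A s := by
  classical
  have hex : ∃ d : ℕ, ∃ f : R[X], f ≠ 0 ∧ aeval a f = 0 ∧ f.natDegree = d := by
    obtain ⟨p, hp0, hpu⟩ := Ring.exists_not_isUnit_of_not_isField hnf
    obtain ⟨n, m, hnm, g, hg⟩ := hfut.exists_pow_smul_eq_aeval p a
    refine ⟨_, _, fun h => ?_, aeval_C_mul_X_sub_comp_eq_zero hg, rfl⟩
    exact coeff_one_C_mul_X_sub_comp_ne_zero hp0 hpu hnm g (by rw [h, coeff_zero])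
  obtain ⟨f, hf0, hfa, hfd⟩ := Nat.find_spec hex
  have hmin : ∀ q : R[X], q ≠ 0 → aeval a q = 0 → f.natDegree ≤ q.natDegree :=
    fun q hq0 hqa => hfd ▸ Nat.find_min' hex ⟨q, hq0, hqa, rfl⟩
  have hc : f.leadingCoeff ≠ 0 := leadingCoeff_ne_zero.mpr hf0
  have hle : f.natDegree ≤ 1 := by
    by_contra! hlt
    have hroot := integralNormalization_aeval_eq_zero hfa
      ((injective_iff_map_eq_zero (algebraMap R A)).mp hinj)
    obtain ⟨q, hq0, hqb, hqd⟩ := hfut.exists_natDegree_lt hnf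
      (monic_integralNormalization hf0) hroot
      (by rw [natDegree_integralNormalization]; exact hlt)
    rw [natDegree_integralNormalization] at hqd
    have hdeg : (q.comp (C f.leadingCoeff * X)).natDegree = q.natDegree := by
      rw [natDegree_comp, natDegree_C_mul_X _ hc, mul_one]
    have hne : q.comp (C f.leadingCoeff * X) ≠ 0 := fun h => hq0 <| by
      rw [← leadingCoeff_eq_zero]
      have h1 := congr_arg (coeff · q.natDegree) h
      simpa [comp_C_mul_X_coeff, hc] using h1
    have := hmin _ hne (by simpa [aeval_comp] using hqb)
    lia
  rw [eq_X_add_C_of_natDegree_le_one hle] at hfa hf0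
  simp only [map_add, map_mul, aeval_C, aeval_X] at hfa
  refine ⟨f.coeff 1, -f.coeff 0, fun h1 => hf0 ?_, ?_⟩
  · rw [h1, map_zero, zero_mul, zero_add, map_eq_zero_iff _ hinj] at hfa
    rw [h1, hfa]
    simp
  · rw [Algebra.smul_def, map_neg]
    exact eq_neg_of_add_eq_zero_left hfa

/-- A torsion-free algebra over a domain in which every element has a nonzero multiple coming
from the base embeds into the fraction field. -/
theorem exists_injective_algHom_fractionRing {R A : Type*} [CommRing R] [IsDomain R]
    [Ring A] [Algebra R A] (hinj : Function.Injective (algebraMap R A))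
    (htf : ∀ (r : R) (a : A), r • a = 0 → r ≠ 0 → a = 0)
    (hfrac : ∀ a : A, ∃ r s : R, r ≠ 0 ∧ r • a = algebraMap R A s) :
    ∃ g : A →ₐ[R] FractionRing R, Function.Injective g := by
  choose r s hr hrs using hfrac
  let φ := algebraMap R (FractionRing R)
  have hφ : ∀ {x : R}, x ≠ 0 → φ x ≠ 0 := fun hx =>
    (map_ne_zero_iff φ (IsFractionRing.injective R (FractionRing R))).mpr hx
  have key : ∀ (a : A) (x y : R), x ≠ 0 → x • a = algebraMap R A y →
      φ (s a) / φ (r a) = φ y / φ x := by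
    intro a x y hx hxy
    rw [div_eq_div_iff (hφ (hr a)) (hφ hx), ← map_mul, ← map_mul]
    congr 1
    apply hinj
    rw [map_mul, map_mul, ← hrs, ← hxy, ← Algebra.commutes, ← Algebra.commutes,
      ← Algebra.smul_def, ← Algebra.smul_def, smul_comm]
  have hmap : ∀ x : R, φ (s (algebraMap R A x)) / φ (r (algebraMap R A x)) = φ x := fun x => by
    rw [key _ 1 x one_ne_zero (one_smul _ _), map_one, div_one]
  refine ⟨{ toFun := fun a => φ (s a) / φ (r a)
            map_one' := by simpa using hmap 1
            map_zero' := by simpa using hmap 0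
            commutes' := hmap
            map_mul' := fun a b => ?_
            map_add' := fun a b => ?_ }, ?_⟩
  · rw [key (a * b) (r a * r b) (s a * s b) (mul_ne_zero (hr a) (hr b)), map_mul, map_mul,
      div_mul_div_comm]
    rw [map_mul, ← hrs, ← hrs, smul_mul_smul_comm]
  · rw [key (a + b) (r a * r b) (s a * r b + r a * s b) (mul_ne_zero (hr a) (hr b)),
      div_add_div _ _ (hφ (hr a)) (hφ (hr b)), map_add, map_mul, map_mul, map_mul]
    rw [map_add, map_mul, map_mul, ← hrs, ← hrs, ← Algebra.commutes, ← Algebra.smul_def,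
      ← Algebra.smul_def, smul_smul, smul_smul, smul_add, mul_comm (r b)]
  · rw [injective_iff_map_eq_zero]
    intro a ha
    have ha' : φ (s a) / φ (r a) = 0 := ha
    have hs : s a = 0 := by
      by_contra hs
      exact div_ne_zero (hφ hs) (hφ (hr a)) ha'
    exact htf (r a) a (by rw [hrs, hs, map_zero]) (hr a)

/-- Let `R` be a domain that is not a field and `A` a nonzero futile `R`-algebra which is
torsion-free as an `R`-module. Then the structure map `R → A` is injective and `A` embeds as
an `R`-algebra into the fraction field `Q(R)`; that is, `R ⊆ A ⊆ Q(R)` up to isomorphism. -/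
theorem futile_torsionFree_embeds_in_fractionField
    {R A : Type*} [CommRing R] [IsDomain R] (hnf : ¬ IsField R)
    [Ring A] [Nontrivial A] [Algebra R A]
    (hfut : IsFutile R A)
    (htf : ∀ (r : R) (a : A), r • a = 0 → r ≠ 0 → a = 0) :
    Function.Injective (algebraMap R A) ∧
      ∃ g : A →ₐ[R] FractionRing R, Function.Injective g := by
  have hinj : Function.Injective (algebraMap R A) := by
    rw [injective_iff_map_eq_zero]
    intro x hx
    by_contra hx0
    exact one_ne_zero (htf x (1 : A) (by rw [← Algebra.algebraMap_eq_smul_one, hx]) hx0)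
  exact ⟨hinj, exists_injective_algHom_fractionRing hinj htf
    (hfut.exists_smul_eq_algebraMap_s17 hnf hinj)⟩
end
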